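/- arXiv:2305.07177 — 2 statements merged into one kernel-verified Lean document; each statement's English description precedes it below -/
import Mathlib

section
/- For every prime p and all positive integers q, c, d there exists a number u = u(c,d,p,q) with the following property: under the standing setup, if C_L(H) is nilpotent of class at most c and C_L(x) is nilpotent of class at most d for every nontrivial x ∈ F, then [L, L_0, …, L_0] = 0, where L_0 occurs u times in the iterated bracket. -/
/-- A group is supersolvable if it has a normal series with cyclic factors all of whose terms
are normal in the whole group.  (Using normality of `s i`, cyclicity of the factor
`s (i+1) ⧸ s i` is expressed by `s (i+1) = s i ⊔ ⟨g⟩` for a single element `g`.) -/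
def IsSupersolvable (G : Type*) [Group G] : Prop :=
  ∃ (n : ℕ) (s : ℕ → Subgroup G), s 0 = ⊥ ∧ s n = ⊤ ∧ (∀ i, (s i).Normal) ∧
    ∀ i < n, ∃ g : G, s (i + 1) = s i ⊔ Subgroup.zpowers g

/-- The fixed-point submodule `C_L(S)` of a set `S` of Lie-algebra automorphisms acting on `L`
via `ρ`.  (It is in fact a Lie subalgebra.) -/
def fixSub {A R L : Type*} [Group A] [CommRing R] [LieRing L] [LieAlgebra R L]
    (ρ : A → (L ≃ₗ⁅R⁆ L)) (S : Set A) : Submodule R L where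
  carrier := {x | ∀ g ∈ S, ρ g x = x}
  add_mem' := by
    intro x y hx hy g hg
    calc (ρ g) (x + y) = (ρ g) x + (ρ g) y := (ρ g).toLieHom.map_add x y
    _ = x + y := by rw [hx g hg, hy g hg]
  zero_mem' := fun g _ => (ρ g).toLieHom.map_zero
  smul_mem' := by
    intro r x hx g hg
    calc (ρ g) (r • x) = r • (ρ g) x := (ρ g).toLieHom.map_smul r x
    _ = r • x := by rw [hx g hg]

/-- The eigenspace of a Lie-algebra automorphism `e` for the eigenvalue `μ`. -/
def eigSp {R L : Type*} [CommRing R] [LieRing L] [LieAlgebra R L]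
    (e : L ≃ₗ⁅R⁆ L) (μ : R) : Submodule R L where
  carrier := {x | e x = μ • x}
  add_mem' := by
    intro x y hx hy
    simp only [Set.mem_setOf_eq] at *
    calc e (x + y) = e x + e y := e.toLieHom.map_add x y
    _ = μ • (x + y) := by rw [hx, hy, smul_add]
  zero_mem' := by
    show e 0 = μ • (0 : L)
    rw [smul_zero]; exact e.toLieHom.map_zero
  smul_mem' := by
    intro r x hx
    simp only [Set.mem_setOf_eq] at *
    calc e (r • x) = r • e x := e.toLieHom.map_smul r x
    _ = μ • r • x := by rw [hx, smul_comm]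

/-- `braSpan R S T` is the `R`-submodule `[S, T]` spanned by all brackets `⁅x, y⁆` with
`x ∈ S`, `y ∈ T`. -/
def braSpan (R : Type*) {L : Type*} [CommRing R] [LieRing L] [LieAlgebra R L]
    (S T : Set L) : Submodule R L :=
  Submodule.span R {z | ∃ x ∈ S, ∃ y ∈ T, ⁅x, y⁆ = z}

/-- `iterBra R S T n` is the left-normed iterated bracket `[S, T, …, T]` with `T` occurring
`n` times (for `n = 0` it is the span of `S`).  In particular a subalgebra with underlying
set `C` is nilpotent of class at most `c` if and only if `iterBra R C C c = ⊥`, and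
`iterBra R Set.univ C c` is the span `[L, C, …, C]`. -/
def iterBra (R : Type*) {L : Type*} [CommRing R] [LieRing L] [LieAlgebra R L]
    (S T : Set L) : ℕ → Submodule R L
  | 0 => Submodule.span R S
  | n + 1 => braSpan R ((iterBra R S T n : Submodule R L) : Set L) T

/-- The conjugate subgroup `H^f = f⁻¹ H f`. -/
def conjSubgroup {A : Type*} [Group A] (f : A) (H : Subgroup A) : Subgroup A :=
  Subgroup.map (MulAut.conj f⁻¹).toMonoidHom H


section Abstract
variable {R E : Type*} [CommRing R] [Ring E] [Algebra R E]

lemma sub_pow_le_S (S B : Submodule R E) (h1 : 1 ≤ S) (hSS : S * S ≤ S) (hB : B ≤ S) (n : ℕ) :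
    B ^ n ≤ S := by
  induction n with
  | zero => simpa using h1
  | succ n ih => rw [pow_succ]; exact (mul_le_mul' ih hB).trans hSS

lemma sub_swap (S J X Y : Submodule R E) (hSS : S * S ≤ S) (h1 : 1 ≤ S) (hY : Y ≤ S)
    (hJS : J * S ≤ J) (hSJ : S * J ≤ J) (hc : Y * X ≤ X * Y + J) (k : ℕ) :
    Y ^ k * X ≤ X * Y ^ k + J := by
  induction k with
  | zero => simp
  | succ k ih =>
    calc Y ^ (k+1) * X = Y ^ k * (Y * X) := by rw [pow_succ, mul_assoc]
      _ ≤ Y ^ k * (X * Y + J) := mul_le_mul' le_rfl hc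
      _ = (Y ^ k * X) * Y + Y ^ k * J := by rw [mul_add, mul_assoc]
      _ ≤ (X * Y ^ k + J) * Y + J := add_le_add (mul_le_mul' ih le_rfl)
          ((mul_le_mul' (sub_pow_le_S S Y h1 hSS hY k) le_rfl).trans hSJ)
      _ = X * Y ^ (k+1) + (J * Y + J) := by rw [add_mul, pow_succ, mul_assoc, add_assoc]
      _ ≤ X * Y ^ (k+1) + J := by
          refine add_le_add le_rfl ?_
          rw [Submodule.add_eq_sup]
          exact sup_le ((mul_le_mul' le_rfl hY).trans hJS) le_rfl

lemma sub_binom (S J X Y : Submodule R E) (hSS : S * S ≤ S) (h1 : 1 ≤ S) (hX : X ≤ S) (hY : Y ≤ S)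
    (hJS : J * S ≤ J) (hSJ : S * J ≤ J) (hc : Y * X ≤ X * Y + J) (a b : ℕ)
    (ha : X ^ a ≤ J) (hb : Y ^ b ≤ J) : (X + Y) ^ (a + b) ≤ J := by
  have key : ∀ n, ∀ P : Submodule R E, (∀ i j, i + j = n → X ^ i * Y ^ j ≤ P) → J ≤ P →
      (X + Y) ^ n ≤ P := by
    intro n
    induction n with
    | zero => intro P h _; simpa using h 0 0 rfl
    | succ n ih =>
      intro P h hJ
      have h2 := ih (⨆ i : ℕ, ⨆ j : ℕ, ⨆ _ : i + j = n, X ^ i * Y ^ j ⊔ J)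
        (fun i j hij => le_iSup_of_le i (le_iSup_of_le j (le_iSup_of_le hij le_sup_left)))
        (le_iSup_of_le 0 (le_iSup_of_le n (le_iSup_of_le (zero_add n) le_sup_right)))
      rw [pow_succ]
      refine (mul_le_mul' h2 le_rfl).trans ?_
      simp only [Submodule.iSup_mul]
      refine iSup_le fun i => iSup_le fun j => iSup_le fun hij => ?_
      rw [Submodule.sup_mul, Submodule.add_eq_sup, Submodule.mul_sup]
      refine sup_le (sup_le ?_ ?_) ?_
      · calc X ^ i * Y ^ j * X = X ^ i * (Y ^ j * X) := mul_assoc _ _ _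
          _ ≤ X ^ i * (X * Y ^ j + J) :=
            mul_le_mul' le_rfl (sub_swap S J X Y hSS h1 hY hJS hSJ hc j)
          _ = X ^ (i+1) * Y ^ j ⊔ X ^ i * J := by
            rw [mul_add, pow_succ, mul_assoc, Submodule.add_eq_sup]
          _ ≤ P := sup_le (h _ _ (by omega))
            (((mul_le_mul' (sub_pow_le_S S X h1 hSS hX i) le_rfl).trans hSJ).trans hJ)
      · rw [mul_assoc, ← pow_succ]; exact h _ _ (by omega)
      · exact ((mul_le_mul' le_rfl (sup_le hX hY)).trans hJS).trans hJ
  refine key _ J ?_ le_rfl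
  intro i j hij
  rcases Nat.lt_or_ge i a with hi | hi
  · have hj : j = (j - b) + b := by omega
    rw [hj, pow_add, ← mul_assoc]
    refine (mul_le_mul' ?_ hb).trans hSJ
    exact (mul_le_mul' (sub_pow_le_S S X h1 hSS hX i)
      (sub_pow_le_S S Y h1 hSS hY _)).trans hSS
  · have hi' : i = a + (i - a) := by omega
    rw [hi', pow_add, mul_assoc]
    refine (mul_le_mul' ha ?_).trans hJS
    exact (mul_le_mul' (sub_pow_le_S S X h1 hSS hX _)
      (sub_pow_le_S S Y h1 hSS hY _)).trans hSS

lemma sub_step (B C : Submodule R E) (hCB : C ≤ B) (hcomm : ∀ x ∈ B, ∀ y ∈ B, x * y - y * x ∈ C)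
    (s : ℕ) (hs : C ^ s = ⊥) (n m : ℕ) (Fam : ℕ → Submodule R E)
    (hFam : ∀ t, Fam t ≤ B) (hm : ∀ t, Fam t ^ m = ⊥)
    (hB : B ≤ (Finset.range n).sup Fam) : B ^ ((n * m + 1) * s) = ⊥ := by
  set S : Submodule R E := Subalgebra.toSubmodule (Algebra.adjoin R (B : Set E)) with hS
  have hSS : S * S ≤ S := by
    rw [Submodule.mul_le]; intro x hx y hy
    exact (Algebra.adjoin R (B : Set E)).mul_mem hx hy
  have h1 : 1 ≤ S := by
    rw [Submodule.one_le]; exact (Algebra.adjoin R (B : Set E)).one_mem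
  have hBS : B ≤ S := fun x hx => Algebra.subset_adjoin hx
  have hswap : ∀ X Y : Submodule R E, X ≤ B → Y ≤ B → Y * X ≤ X * Y + C := by
    intro X Y hX hY
    rw [Submodule.mul_le]; intro y hy x hx
    have : y * x = x * y + (y * x - x * y) := by abel
    rw [this]
    exact Submodule.add_mem_sup (Submodule.mul_mem_mul hx hy) (hcomm _ (hY hy) _ (hX hx))
  set J := C * S with hJ
  have hCJ : C ≤ J := by
    calc C = C * 1 := (mul_one _).symm
      _ ≤ C * S := mul_le_mul' le_rfl h1
  have hJS : J * S ≤ J := by rw [hJ, mul_assoc]; exact mul_le_mul' le_rfl hSS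
  have hBJ : B * J ≤ J := by
    rw [hJ, ← mul_assoc]
    refine (mul_le_mul' (hswap C B hCB le_rfl) le_rfl).trans ?_
    rw [add_mul, Submodule.add_eq_sup]
    refine sup_le ?_ le_rfl
    rw [mul_assoc]
    exact mul_le_mul' le_rfl ((mul_le_mul' hBS le_rfl).trans hSS)
  have hSJ : S * J ≤ J := by
    rw [Submodule.mul_le]; intro x hx
    change x ∈ Algebra.adjoin R (B : Set E) at hx
    induction hx using Algebra.adjoin_induction with
    | mem x hx => intro y hy; exact hBJ (Submodule.mul_mem_mul hx hy)
    | algebraMap r => intro y hy; rw [← Algebra.smul_def]; exact J.smul_mem _ hy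
    | add a b _ _ ha hb => intro y hy; rw [add_mul]; exact J.add_mem (ha y hy) (hb y hy)
    | mul a b _ _ ha hb => intro y hy; rw [mul_assoc]; exact ha _ (hb y hy)
  have hpart : ∀ k, ((Finset.range k).sup Fam) ^ (k * m + 1) ≤ J := by
    intro k
    induction k with
    | zero => simp
    | succ k ih =>
      have hW : (Finset.range k).sup Fam ≤ B := Finset.sup_le fun t _ => hFam t
      have e1 : (Finset.range (k+1)).sup Fam = (Finset.range k).sup Fam + Fam k := by
        rw [Finset.range_add_one, Finset.sup_insert, Submodule.add_eq_sup, sup_comm]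
      have e2 : (k+1) * m + 1 = (k * m + 1) + m := by ring
      rw [e1, e2]
      refine sub_binom S J _ _ hSS h1 (hW.trans hBS) ((hFam k).trans hBS) hJS hSJ ?_ _ _ ih ?_
      · exact (hswap _ _ hW (hFam k)).trans (add_le_add le_rfl hCJ)
      · rw [hm]; exact bot_le
  have hBN : B ^ (n * m + 1) ≤ J := (pow_le_pow_left' hB _).trans (hpart n)
  have hSC : S * C ≤ J := (mul_le_mul' le_rfl hCJ).trans hSJ
  have hJpow : ∀ k, J ^ k ≤ C ^ k * S := by
    intro k
    induction k with
    | zero => simpa using h1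
    | succ k ih =>
      calc J ^ (k+1) = J ^ k * J := pow_succ _ _
        _ ≤ (C ^ k * S) * J := mul_le_mul' ih le_rfl
        _ = C ^ k * (S * J) := mul_assoc _ _ _
        _ ≤ C ^ k * J := mul_le_mul' le_rfl hSJ
        _ = C ^ (k+1) * S := by rw [hJ, pow_succ, mul_assoc]
  rw [pow_mul, eq_bot_iff]
  refine (pow_le_pow_left' hBN s).trans ((hJpow s).trans ?_)
  rw [hs, Submodule.bot_mul]

end Abstract

section LieSec
variable {R L : Type*} [CommRing R] [LieRing L] [LieAlgebra R L]

/-- The image of a submodule under the adjoint map. -/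
def adM (T : Submodule R L) : Submodule R (Module.End R L) :=
  T.map (LieAlgebra.ad R L : L →ₗ[R] Module.End R L)

lemma mem_adM {T : Submodule R L} {y : L} (hy : y ∈ T) :
    (LieAlgebra.ad R L y : Module.End R L) ∈ adM T := ⟨y, hy, rfl⟩

/-- Induction principle for powers of `adM T`. -/
lemma adM_pow_induction (T : Submodule R L) (C : ℕ → Module.End R L → Prop)
    (h1 : C 0 1) (hsm : ∀ (r : R) n Q, C n Q → C n (r • Q))
    (hadd : ∀ n P Q, C n P → C n Q → C n (P + Q))
    (hmul : ∀ y ∈ T, ∀ n Q, C n Q → C (n+1) ((LieAlgebra.ad R L y : Module.End R L) * Q))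
    (n : ℕ) (Q : Module.End R L) (hQ : Q ∈ adM T ^ n) : C n Q := by
  induction hQ using Submodule.pow_induction_on_left' with
  | algebraMap r => rw [Algebra.algebraMap_eq_smul_one]; exact hsm _ _ _ h1
  | add x y i hx hy h1 h2 => exact hadd _ _ _ h1 h2
  | mem_mul m hm i x hx ih =>
    obtain ⟨y, hy, rfl⟩ := hm
    exact hmul y hy _ _ ih

lemma adM_pow_apply_mem (T : Submodule R L) (S : Set L) (U : Set L) (hU : (T : Set L) ⊆ U) (v : L)
    (hv : v ∈ S) (n : ℕ) (Q : Module.End R L) (hQ : Q ∈ adM T ^ n) : Q v ∈ iterBra R S U n := by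
  refine adM_pow_induction T (fun n Q => Q v ∈ iterBra R S U n) ?_ ?_ ?_ ?_ n Q hQ
  · exact Submodule.subset_span hv
  · intro r n Q h; exact Submodule.smul_mem _ _ h
  · intro n P Q h1 h2; exact Submodule.add_mem _ h1 h2
  · intro y hy n Q h
    change ⁅y, Q v⁆ ∈ _
    rw [← lie_skew]
    exact Submodule.neg_mem _ (Submodule.subset_span ⟨_, h, y, hU hy, rfl⟩)

lemma adM_pow_apply_mem_sub (T N : Submodule R L) (hN : ∀ y ∈ T, ∀ x ∈ N, ⁅y, x⁆ ∈ N) (v : L)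
    (hv : v ∈ N) (n : ℕ) (Q : Module.End R L) (hQ : Q ∈ adM T ^ n) : Q v ∈ N := by
  refine adM_pow_induction T (fun n Q => Q v ∈ N) ?_ ?_ ?_ ?_ n Q hQ
  · exact hv
  · intro r n Q h; exact Submodule.smul_mem _ _ h
  · intro n P Q h1 h2; exact Submodule.add_mem _ h1 h2
  · intro y hy n Q h; exact hN y hy _ h

lemma adM_pow_comm (T : Submodule R L) (e : L ≃ₗ⁅R⁆ L) (he : ∀ y ∈ T, e y = y) (v : L)
    (n : ℕ) (Q : Module.End R L) (hQ : Q ∈ adM T ^ n) : Q (e v) = e (Q v) := by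
  refine adM_pow_induction T (fun n Q => Q (e v) = e (Q v)) ?_ ?_ ?_ ?_ n Q hQ
  · rfl
  · intro r n Q h; simp [h]
  · intro n P Q h1 h2; simp [h1, h2]
  · intro y hy n Q h
    change ⁅y, Q (e v)⁆ = e ⁅y, Q v⁆
    rw [h, LieEquiv.map_lie, he y hy]

lemma adM_pow_map (T : Submodule R L) (e : L ≃ₗ⁅R⁆ L) (T' : Submodule R L)
    (hT' : ∀ y ∈ T', ∃ z ∈ T, e z = y)
    (n : ℕ) (hn : adM T ^ n = ⊥) : adM T' ^ n = ⊥ := by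
  rw [eq_bot_iff]
  intro Q hQ
  have : ∃ Q' ∈ adM T ^ n, ∀ v, Q (e v) = e (Q' v) := by
    refine adM_pow_induction T' (fun n Q => ∃ Q' ∈ adM T ^ n, ∀ v, Q (e v) = e (Q' v))
      ?_ ?_ ?_ ?_ n Q hQ
    · exact ⟨1, by rw [pow_zero]; exact Submodule.one_le.1 le_rfl, fun v => rfl⟩
    · rintro r n Q ⟨Q', h, h'⟩; exact ⟨r • Q', Submodule.smul_mem _ _ h, fun v => by simp [h']⟩
    · rintro n P Q ⟨P', h1, h1'⟩ ⟨Q', h, h'⟩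
      exact ⟨P' + Q', Submodule.add_mem _ h1 h, fun v => by simp [h', h1']⟩
    · rintro y hy n Q ⟨Q', h, h'⟩
      obtain ⟨z, hz, rfl⟩ := hT' y hy
      refine ⟨(LieAlgebra.ad R L z : Module.End R L) * Q', ?_, ?_⟩
      · rw [pow_succ']; exact Submodule.mul_mem_mul (mem_adM hz) h
      · intro v
        change ⁅e z, Q (e v)⁆ = e ⁅z, Q' v⁆
        rw [h', LieEquiv.map_lie]
  obtain ⟨Q', h, h'⟩ := this
  rw [hn, Submodule.mem_bot] at h
  subst h
  rw [Submodule.mem_bot]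
  ext v
  have := h' (e.symm v)
  simpa using this

lemma adM_pow_kill_mono (T : Submodule R L) (a n : ℕ) (han : a ≤ n) (v : L)
    (h : ∀ Q ∈ adM T ^ a, Q v = 0) : ∀ Q ∈ adM T ^ n, Q v = 0 := by
  obtain ⟨b, rfl⟩ := Nat.exists_eq_add_of_le' han
  intro Q hQ
  rw [pow_add] at hQ
  induction hQ using Submodule.mul_induction_on' with
  | mem_mul_mem m hm n hn => rw [Module.End.mul_apply, h n hn, map_zero]
  | add x hx y hy h1 h2 => simp [h1, h2]

lemma iterBra_univ_eq_bot (T : Submodule R L) (u : ℕ) (h : adM T ^ u = ⊥) :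
    iterBra R (Set.univ : Set L) (T : Set L) u = ⊥ := by
  have key : ∀ n, iterBra R (Set.univ : Set L) (T : Set L) n ≤
      Submodule.span R {z | ∃ Q ∈ adM T ^ n, ∃ v, Q v = z} := by
    intro n
    induction n with
    | zero =>
      refine Submodule.span_le.2 fun x _ => Submodule.subset_span ⟨1, by rw [pow_zero]; exact Submodule.one_le.1 le_rfl, x, rfl⟩
    | succ n ih =>
      refine Submodule.span_le.2 ?_
      rintro _ ⟨x, hx, y, hy, rfl⟩
      suffices H : Submodule.span R {z | ∃ Q ∈ adM T ^ n, ∃ v, Q v = z} ≤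
          (Submodule.span R {z | ∃ Q ∈ adM T ^ (n+1), ∃ v, Q v = z}).comap
            (LieAlgebra.ad R L y : L →ₗ[R] L) by
        rw [SetLike.mem_coe, ← lie_skew]
        exact Submodule.neg_mem _ (H (ih hx))
      refine Submodule.span_le.2 ?_
      rintro _ ⟨Q, hQ, v, rfl⟩
      refine Submodule.subset_span ⟨(LieAlgebra.ad R L y : Module.End R L) * Q, ?_, v, rfl⟩
      rw [pow_succ']; exact Submodule.mul_mem_mul (mem_adM hy) hQ
  rw [eq_bot_iff]
  refine (key u).trans (Submodule.span_le.2 ?_)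
  rintro _ ⟨Q, hQ, v, rfl⟩
  rw [h, Submodule.mem_bot] at hQ
  simp [hQ]

end LieSec

section Grp
variable {A : Type*} [Group A] [Finite A]

lemma grp_exists_psi (p : ℕ) (hp : p.Prime) (F Z : Subgroup A) (hFcard : Nat.card F = p ^ 2)
    (hZF : Z ≤ F) (hZcard : Nat.card Z = p) : ∃ ψ ∈ F, ψ ∉ Z := by
  by_contra! h
  have h' : F ≤ Z := h
  have : F = Z := le_antisymm h' hZF
  rw [this, hZcard] at hFcard
  have := hp.two_le
  nlinarith

lemma grp_phi_ne (p : ℕ) (hp : p.Prime) (Z : Subgroup A) (hZcard : Nat.card Z = p) (φ : A)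
    (hφgen : Z ≤ Subgroup.zpowers φ) : φ ≠ 1 := by
  rintro rfl
  rw [Subgroup.zpowers_one_eq_bot, le_bot_iff] at hφgen
  subst hφgen
  simp at hZcard
  exact hp.one_lt.ne hZcard

/-- `F` is generated by `Z` and `ψ`. -/
lemma grp_gen (p : ℕ) (hp : p.Prime) (F Z : Subgroup A) (hFcard : Nat.card F = p ^ 2)
    (hFab : ∀ f ∈ F, ∀ g ∈ F, f * g = g * f)
    (hZF : Z ≤ F) (hZcard : Nat.card Z = p) (ψ : A) (hψF : ψ ∈ F) (hψZ : ψ ∉ Z) :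
    ∀ f ∈ F, ∃ s : ℕ, ∃ z ∈ Z, f = ψ ^ s * z := by
  -- the subgroup of all products
  let K : Subgroup A :=
    { carrier := {f | ∃ s : ℕ, ∃ z ∈ Z, f = ψ ^ s * z}
      one_mem' := ⟨0, 1, Z.one_mem, by simp⟩
      mul_mem' := by
        rintro _ _ ⟨s, z, hz, rfl⟩ ⟨t, w, hw, rfl⟩
        refine ⟨s + t, z * w, Z.mul_mem hz hw, ?_⟩
        have := hFab z (hZF hz) (ψ ^ t) (F.pow_mem hψF t)
        rw [pow_add, mul_assoc, ← mul_assoc z, this]; simp only [mul_assoc]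
      inv_mem' := by
        rintro _ ⟨s, z, hz, rfl⟩
        obtain ⟨t, ht⟩ : ∃ t : ℕ, (ψ ^ s)⁻¹ = ψ ^ t := by
          have : (ψ ^ s)⁻¹ ∈ Subgroup.zpowers ψ :=
            inv_mem (pow_mem (Subgroup.mem_zpowers ψ) s)
          obtain ⟨t, ht⟩ := (mem_powers_iff_mem_zpowers).2 this
          exact ⟨t, ht.symm⟩
        refine ⟨t, z⁻¹, Z.inv_mem hz, ?_⟩
        rw [mul_inv_rev, ht]
        exact hFab _ (hZF (Z.inv_mem hz)) _ (F.pow_mem hψF t) }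
  have hZK : Z ≤ K := fun z hz => ⟨0, z, hz, by simp⟩
  have hψK : ψ ∈ K := ⟨1, 1, Z.one_mem, by simp⟩
  have hKF : K ≤ F := by
    rintro _ ⟨s, z, hz, rfl⟩; exact F.mul_mem (F.pow_mem hψF s) (hZF hz)
  have hdvd : Nat.card K ∣ p ^ 2 := hFcard ▸ Subgroup.card_dvd_of_le hKF
  have hdvd2 : p ∣ Nat.card K := hZcard ▸ Subgroup.card_dvd_of_le hZK
  have hne : Nat.card K ≠ p := by
    intro h
    have : Z = K := Subgroup.eq_of_le_of_card_ge hZK (by rw [h, hZcard])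
    rw [this] at hψZ; exact hψZ hψK
  have hcard : Nat.card K = p ^ 2 := by
    obtain ⟨k, hk, hk'⟩ := (Nat.dvd_prime_pow hp).1 hdvd
    interval_cases k
    · rw [hk', pow_zero] at hdvd2; exact absurd (Nat.dvd_one.1 hdvd2) hp.one_lt.ne'
    · simp at hk'; exact absurd hk' hne
    · exact hk'
  have : K = F := Subgroup.eq_of_le_of_card_ge hKF (by rw [hcard, hFcard])
  intro f hf
  rw [← this] at hf
  exact hf

lemma grp_psi_frob (F H Z : Subgroup A) (hfrob : ∀ x ∈ H, x ≠ 1 → ∀ f ∈ F, x * f = f * x → f = 1)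
    (hFab : ∀ f ∈ F, ∀ g ∈ F, f * g = g * f) (hFnorm : F.Normal)
    (hZF : Z ≤ F) (hZnorm : Z.Normal) (ψ : A) (hψF : ψ ∈ F) (hψZ : ψ ∉ Z)
    (h : A) (hh : h ∈ H) (h1 : h ≠ 1) (z : A) (hz : z ∈ Z) (heq : h⁻¹ * ψ * h = ψ * z) : False := by
  have hconj : ∀ f, f ∈ Z → h⁻¹ * f * h ∈ Z := fun f hf => by
    simpa using hZnorm.conj_mem f hf h⁻¹
  have hconjF : ∀ f, f ∈ F → h⁻¹ * f * h ∈ F := fun f hf => by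
    simpa using hFnorm.conj_mem f hf h⁻¹
  have hfix : ∀ f ∈ F, h⁻¹ * f * h = f → f = 1 := by
    intro f hf e
    apply hfrob h hh h1 f hf
    calc h * f = h * (h⁻¹ * f * h) := by rw [e]
      _ = f * h := by group
  -- two elements with the same commutator with h are equal
  have hinj : ∀ f ∈ F, ∀ g ∈ F, f⁻¹ * (h⁻¹ * f * h) = g⁻¹ * (h⁻¹ * g * h) → f = g := by
    intro f hf g hg e
    have hgf : g⁻¹ * f ∈ F := F.mul_mem (F.inv_mem hg) hf
    have : g⁻¹ * f = 1 := by
      apply hfix _ hgf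
      have e1 : h⁻¹ * f * h = f * (g⁻¹ * (h⁻¹ * g * h)) := by rw [← e]; group
      have e2 : h⁻¹ * (g⁻¹ * f) * h = (h⁻¹ * g * h)⁻¹ * (h⁻¹ * f * h) := by group
      rw [e2, e1, inv_mul_eq_iff_eq_mul, ← mul_assoc f, hFab (f * g⁻¹)
        (F.mul_mem hf (F.inv_mem hg)) _ (hconjF g hg), hFab f hf _ (F.inv_mem hg)]
    rw [inv_mul_eq_one] at this
    exact this.symm
  let θ : Z → Z := fun f => ⟨(f : A)⁻¹ * (h⁻¹ * f * h), Z.mul_mem (Z.inv_mem f.2) (hconj f f.2)⟩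
  have hθ : Function.Injective θ := by
    intro f g e
    exact Subtype.ext (hinj f (hZF f.2) g (hZF g.2) (congrArg Subtype.val e))
  obtain ⟨f, hf⟩ := (Finite.surjective_of_injective hθ) ⟨z, hz⟩
  have hf' : (f : A)⁻¹ * (h⁻¹ * f * h) = z := congrArg Subtype.val hf
  have : (f : A) = ψ := by
    apply hinj f (hZF f.2) ψ hψF
    rw [hf', heq]; group
  exact hψZ (this ▸ f.2)

end Grp

section Sums
variable {R L : Type*} [CommRing R] [LieRing L] [LieAlgebra R L]

lemma omega_inj (p : ℕ) (hp : p.Prime) (ω : R) (e : L ≃ₗ⁅R⁆ L)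
    (Li : ZMod p → Submodule R L) (hLi : ∀ i : ZMod p, Li i = eigSp e (ω ^ i.val))
    (hdec : DirectSum.IsInternal Li) (x : L) (hx : ω • x = x) : x = 0 := by
  have := Fact.mk hp
  have hpow : ∀ y : L, ω • y = y → ∀ n : ℕ, ω ^ n • y = y := by
    intro y hy n
    induction n with
    | zero => simp
    | succ n ih => rw [pow_succ, mul_smul, hy, ih]
  have hcomp : ∀ i, ∀ y ∈ Li i, ω • y = y → y = 0 := by
    intro i y hy h
    have hey : e y = y := by
      rw [hLi] at hy
      have : e y = ω ^ i.val • y := hy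
      rw [this, hpow y h]
    have hall : ∀ j, y ∈ Li j := by
      intro j; rw [hLi]; change e y = _; rw [hey, hpow y h]
    have hind := hdec.submodule_iSupIndep
    have hdis := hind.pairwiseDisjoint (show (0 : ZMod p) ≠ 1 from zero_ne_one)
    exact Submodule.disjoint_def.1 hdis y (hall 0) (hall 1)
  obtain ⟨f, rfl⟩ := hdec.2 x
  have hf : ω • f = f := by
    apply hdec.1
    change DirectSum.coeLinearMap Li (ω • f) = _
    rw [map_smul]; exact hx
  have : f = 0 := by
    ext i
    have h1 : ω • (f i) = f i := by
      conv_rhs => rw [← hf]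
      rfl
    have := hcomp i (f i) (f i).2 (by
      have := congrArg Subtype.val h1
      exact this)
    simpa using this
  rw [this, map_zero]

lemma omega_sum (p : ℕ) (hp : p.Prime) (ω : R) (hω : ω ^ p = 1)
    (hinj : ∀ x : L, ω • x = x → x = 0) (e : ℕ) (he : ¬ p ∣ e) (x : L) :
    ∑ k ∈ Finset.range p, ω ^ (e * k) • x = 0 := by
  rw [← Finset.sum_smul]
  set y := (∑ k ∈ Finset.range p, ω ^ (e * k)) • x with hy
  have h1 : ω ^ e • y = y := by
    have : (ω ^ e - 1) • y = 0 := by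
      rw [hy, smul_smul]
      simp only [pow_mul]
      rw [mul_geom_sum, ← pow_mul, mul_comm e p, pow_mul, hω, one_pow, sub_self, zero_smul]
    rwa [sub_smul, one_smul, sub_eq_zero] at this
  have h2 : ∀ n : ℕ, ω ^ (e * n) • y = y := by
    intro n
    induction n with
    | zero => simp
    | succ n ih => rw [mul_add, pow_add, mul_smul, mul_one, h1, ih]
  obtain ⟨n, -, hn⟩ := Nat.exists_mul_mod_eq_one_of_coprime
    ((hp.coprime_iff_not_dvd.2 he).symm) hp.one_lt
  apply hinj
  conv_rhs => rw [← h2 n]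
  rw [pow_eq_pow_mod (e * n) hω, hn, pow_one]

variable {A : Type*} [Group A] (ρ : A → (L ≃ₗ⁅R⁆ L))

lemma rho_pow_eig (hρone : ∀ x : L, ρ 1 x = x)
    (hρmul : ∀ g₁ g₂ : A, ∀ x : L, ρ (g₁ * g₂) x = ρ g₁ (ρ g₂ x)) (ω : R) (g : A) (y : L) (i : ℕ)
    (h : ρ g y = ω ^ i • y) (k : ℕ) : ρ (g ^ k) y = ω ^ (i * k) • y := by
  induction k with
  | zero => simp [hρone]
  | succ k ih => rw [pow_succ, hρmul, h, map_smul, ih, smul_smul, ← pow_add]; congr 2; ring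

lemma orbit_proj (p : ℕ) (hp : p.Prime) (ω : R) (hω : ω ^ p = 1)
    (hsum : ∀ e, ¬ p ∣ e → ∀ x : L, ∑ k ∈ Finset.range p, ω ^ (e * k) • x = 0)
    (hρone : ∀ x : L, ρ 1 x = x)
    (hρmul : ∀ g₁ g₂ : A, ∀ x : L, ρ (g₁ * g₂) x = ρ g₁ (ρ g₂ x))
    (H : Subgroup A) [Fintype H] (g : A) (y : L) (i : ℕ) (hy : ρ g y = ω ^ i • y)
    (hh : ∀ h ∈ H, h ≠ 1 → ∃ e : ℕ, ρ g (ρ h y) = ω ^ e • ρ h y ∧ ¬ e ≡ i [MOD p]) :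
    ∑ k ∈ Finset.range p, ω ^ ((p - 1) * i * k) • ρ (g ^ k) (∑ h : H, ρ h y) = (p : R) • y := by
  have hterm : ∀ x : L, ∀ e : ℕ, ρ g x = ω ^ e • x → ∀ k : ℕ,
      ω ^ ((p - 1) * i * k) • ρ (g ^ k) x = ω ^ (((p - 1) * i + e) * k) • x := by
    intro x e hx k
    rw [rho_pow_eig ρ hρone hρmul ω g x e hx, smul_smul, ← pow_add]; congr 2; ring
  have hadd : (p - 1) * i + i = p * i := by
    obtain ⟨m, hm⟩ : ∃ m, p = m + 1 := ⟨p - 1, by have := hp.pos; omega⟩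
    subst hm; simp; ring
  simp only [map_sum, Finset.smul_sum]
  rw [Finset.sum_comm, Finset.sum_eq_single (1 : H)]
  · rw [Finset.sum_congr rfl (fun k _ => ?_)]
    rotate_left
    · exact fun _ => y
    · rw [OneMemClass.coe_one, hρone, hterm y i hy, hadd, mul_assoc, pow_mul, hω, one_pow, one_smul]
    · rw [Finset.sum_const, Finset.card_range, Nat.cast_smul_eq_nsmul]
  · intro h _ h1
    obtain ⟨e, he, hne⟩ := hh h h.2 (fun h' => h1 (Subtype.ext h'))
    rw [Finset.sum_congr rfl (fun k _ => hterm _ e he k)]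
    apply hsum
    intro hdvd
    apply hne
    have h2 : (p - 1) * i + e ≡ (p - 1) * i + i [MOD p] := by
      rw [hadd]
      exact ((Nat.modEq_zero_iff_dvd).2 hdvd).trans
        ((Nat.modEq_zero_iff_dvd).2 (dvd_mul_right p i)).symm
    exact Nat.ModEq.add_left_cancel' _ h2
  · intro h; exact absurd (Finset.mem_univ _) h

lemma weight_ind (p : ℕ) (hp : p.Prime) (ω : R) (hω : ω ^ p = 1) (hpu : IsUnit (p : R))
    (hsum : ∀ e, ¬ p ∣ e → ∀ x : L, ∑ k ∈ Finset.range p, ω ^ (e * k) • x = 0)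
    (hρone : ∀ x : L, ρ 1 x = x)
    (hρmul : ∀ g₁ g₂ : A, ∀ x : L, ρ (g₁ * g₂) x = ρ g₁ (ρ g₂ x))
    (g : A) (hg : g ^ p = 1) (N P : Submodule R L) (hN : ∀ x ∈ N, ρ g x ∈ N)
    (hP : ∀ i : ℕ, ∀ y ∈ N, ρ g y = ω ^ i • y → y ∈ P) : N ≤ P := by
  intro v hv
  have hNk : ∀ k : ℕ, ρ (g ^ k) v ∈ N := by
    intro k
    induction k with
    | zero => simpa [hρone] using hv
    | succ k ih => rw [pow_succ', hρmul]; exact hN _ ih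
  have h1 : ∀ j, ∑ k ∈ Finset.range p, ω ^ (j * k) • ρ (g ^ k) v ∈ P := by
    intro j
    refine hP ((p - 1) * j) _ (Submodule.sum_mem _ fun k _ => Submodule.smul_mem _ _ (hNk k)) ?_
    rw [map_sum, Finset.smul_sum]
    have hmul : ω ^ ((p - 1) * j) * ω ^ j = 1 := by
      obtain ⟨m, hm⟩ : ∃ m, p = m + 1 := ⟨p - 1, by have := hp.pos; omega⟩
      rw [← pow_add]
      have : (p - 1) * j + j = p * j := by subst hm; simp; ring
      rw [this, pow_mul, hω, one_pow]
    have hshift : ∀ k, ρ g (ω ^ (j * k) • ρ (g ^ k) v) =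
        ω ^ ((p - 1) * j) • (ω ^ (j * (k+1)) • ρ (g ^ (k+1)) v) := by
      intro k
      rw [map_smul, ← hρmul, ← pow_succ', smul_smul]
      congr 1
      rw [mul_add, mul_one, pow_add, mul_comm (ω ^ (j * k)), ← mul_assoc, hmul, one_mul]
    rw [Finset.sum_congr rfl (fun k _ => hshift k), ← Finset.smul_sum, ← Finset.smul_sum]
    congr 1
    have a1 := Finset.sum_range_succ (fun k => ω ^ (j * k) • ρ (g ^ k) v) p
    have a2 := Finset.sum_range_succ' (fun k => ω ^ (j * k) • ρ (g ^ k) v) p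
    rw [a1] at a2
    have a3 : ω ^ (j * p) • ρ (g ^ p) v = ω ^ (j * 0) • ρ (g ^ 0) v := by
      rw [hg, mul_comm j p, pow_mul, hω]; simp
    rw [a3] at a2
    exact (add_right_cancel a2).symm
  have h2 : ∑ j ∈ Finset.range p, ∑ k ∈ Finset.range p, ω ^ (j * k) • ρ (g ^ k) v = (p : R) • v := by
    rw [Finset.sum_comm, Finset.sum_eq_single 0]
    · simp [hρone, Nat.cast_smul_eq_nsmul]
    · intro k hk hk0
      simp only [mul_comm _ k]
      apply hsum
      intro hd
      have := Nat.le_of_dvd (Nat.pos_of_ne_zero hk0) hd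
      have := Finset.mem_range.1 hk
      omega
    · intro h; exact absurd (Finset.mem_range.2 hp.pos) h
  have h3 : (p : R) • v ∈ P := h2 ▸ Submodule.sum_mem _ fun j _ => h1 j
  exact (Submodule.smul_mem_iff_of_isUnit P hpu).1 h3

end Sums

/-- For every prime `p` and positive integers `q`, `c`, `d` there is `u = u(c, d, p, q)`
such that, in the standing setup (a supersolvable Frobenius group `FH` — the finite group
`A` with kernel `F` elementary abelian of order `p^2` and cyclic complement `H` of order
`q` — a subgroup `Z ≤ F` of order `p` normal in `FH` with generator `φ`, a finite
commutative ring `R` with a primitive `p`-th root of unity `ω` in which `p` is invertible,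
a Lie algebra `L` over `R` on which `FH` acts via `ρ`, and the eigenspace decomposition
`L = ⊕ L_i` of `ρ φ`): if `C_L(H)` is nilpotent of class at most `c` and `C_L(x)` is
nilpotent of class at most `d` for every `x ∈ F^#`, then `[L, L_0, …, L_0] = 0` with
`L_0` occurring `u` times. -/
theorem bounded_bracket_with_zero_component
    (p q c d : ℕ) (hp : p.Prime) (hq : 0 < q) (hc : 0 < c) (hd : 0 < d) :
    ∃ u : ℕ, ∀
    (A : Type*) [Group A] [Finite A] (F H : Subgroup A)
    (hFnorm : F.Normal) (hFH : F ⊓ H = ⊥) (hFHtop : F ⊔ H = ⊤)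
    (hFnt : F ≠ ⊥) (hHnt : H ≠ ⊥)
    (hfrob : ∀ x ∈ H, x ≠ 1 → ∀ f ∈ F, x * f = f * x → f = 1)
    (hss : IsSupersolvable A)
    (hFcard : Nat.card F = p ^ 2) (hFexp : ∀ f ∈ F, f ^ p = 1)
    (hFab : ∀ f ∈ F, ∀ g ∈ F, f * g = g * f)
    (hHcard : Nat.card H = q) (hHcyc : IsCyclic H)
    (Z : Subgroup A) (hZF : Z ≤ F) (hZnorm : Z.Normal) (hZcard : Nat.card Z = p)
    (φ : A) (hφZ : φ ∈ Z) (hφgen : Z ≤ Subgroup.zpowers φ)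
    (R : Type*) [CommRing R] [Finite R]
    (ω : R) (hω : IsPrimitiveRoot ω p) (hpu : IsUnit (p : R))
    (L : Type*) [LieRing L] [LieAlgebra R L]
    (ρ : A → (L ≃ₗ⁅R⁆ L))
    (hρone : ∀ x : L, ρ 1 x = x)
    (hρmul : ∀ g₁ g₂ : A, ∀ x : L, ρ (g₁ * g₂) x = ρ g₁ (ρ g₂ x))
    (Li : ZMod p → Submodule R L)
    (hLi : ∀ i : ZMod p, Li i = eigSp (ρ φ) (ω ^ i.val))
    (hdec : DirectSum.IsInternal Li)
      (hcH : iterBra R (fixSub ρ (H : Set A) : Set L)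
        (fixSub ρ (H : Set A) : Set L) c = ⊥)
      (hdF : ∀ x ∈ F, x ≠ 1 →
        iterBra R (fixSub ρ {x} : Set L) (fixSub ρ {x} : Set L) d = ⊥),
      iterBra R (Set.univ : Set L) (Li 0 : Set L) u = ⊥ := by
  refine ⟨((p + 1) * (c + d) + 1) ^ d, ?_⟩
  intro A _ _ F H hFnorm hFH hFHtop hFnt hHnt hfrob hss hFcard hFexp hFab hHcard hHcyc Z hZF
    hZnorm hZcard φ hφZ hφgen R _ _ ω hω hpu L _ _ ρ hρone hρmul Li hLi hdec hcH hdF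
  have := Fact.mk hp
  have hωp : ω ^ p = 1 := hω.pow_eq_one
  have hinj : ∀ x : L, ω • x = x → x = 0 := omega_inj p hp ω (ρ φ) Li hLi hdec
  have hsum := omega_sum (L := L) p hp ω hωp hinj
  obtain ⟨ψ, hψF, hψZ⟩ := grp_exists_psi p hp F Z hFcard hZF hZcard
  have hφ1 := grp_phi_ne p hp Z hZcard φ hφgen
  have hφF := hZF hφZ
  have hφp := hFexp φ hφF
  have hψp := hFexp ψ hψF
  have := Fintype.ofFinite H
  have hEig : ∀ i : ZMod p, ∀ x, x ∈ Li i ↔ ρ φ x = ω ^ i.val • x := by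
    intro i x; rw [hLi]; rfl
  have hL0 : ∀ x, x ∈ Li 0 ↔ ρ φ x = x := by
    intro x; rw [hEig, ZMod.val_zero, pow_zero, one_smul]
  have hL0set : (Li 0 : Set L) = (fixSub ρ {φ} : Set L) := by
    ext x
    rw [SetLike.mem_coe, hL0]
    constructor
    · rintro h g rfl; exact h
    · intro h; exact h φ rfl
  have hLie : ∀ i, ∀ y ∈ Li 0, ∀ x ∈ Li i, ⁅y, x⁆ ∈ Li i := by
    intro i y hy x hx
    rw [hL0] at hy
    rw [hEig] at hx ⊢
    rw [LieEquiv.map_lie, hy, hx, lie_smul]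
  have htop : iSup Li = ⊤ := hdec.submodule_iSup_eq_top
  have hZpow : ∀ z ∈ Z, ∃ r : ℕ, z = φ ^ r := by
    intro z hz
    obtain ⟨t, ht⟩ := (mem_powers_iff_mem_zpowers).2 (hφgen hz)
    exact ⟨t, ht.symm⟩
  have hZfix : ∀ z ∈ Z, ∀ x ∈ Li 0, ρ z x = x := by
    intro z hz x hx
    obtain ⟨r, rfl⟩ := hZpow z hz
    have := rho_pow_eig ρ hρone hρmul ω φ x 0 (by rw [(hL0 x).1 hx]; simp) r
    simpa using this
  have hmove : ∀ g f : A, ∀ x : L, ρ f (ρ g x) = ρ g (ρ (g⁻¹ * f * g) x) := by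
    intro g f x
    rw [← hρmul, ← hρmul]; congr 2; group
  have hL0inv : ∀ g : A, ∀ x ∈ Li 0, ρ g x ∈ Li 0 := by
    intro g x hx
    rw [hL0, hmove, hZfix _ _ x hx]
    simpa using hZnorm.conj_mem φ hφZ g⁻¹
  have hφh : ∀ h ∈ H, h ≠ 1 → ∃ r : ℕ, h⁻¹ * φ * h = φ ^ r ∧ ¬ r ≡ 1 [MOD p] := by
    intro h hh h1
    obtain ⟨r, hr⟩ := hZpow (h⁻¹ * φ * h) (by simpa using hZnorm.conj_mem φ hφZ h⁻¹)
    refine ⟨r, hr, fun hmod => hφ1 ?_⟩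
    rw [pow_eq_pow_of_modEq hmod hφp, pow_one] at hr
    apply hfrob h hh h1 φ hφF
    calc h * φ = h * (h⁻¹ * φ * h) := by rw [hr]
      _ = φ * h := by group
  have hψh : ∀ h ∈ H, h ≠ 1 → ∃ s : ℕ, ∃ z ∈ Z, h⁻¹ * ψ * h = ψ ^ s * z ∧ ¬ s ≡ 1 [MOD p] := by
    intro h hh h1
    obtain ⟨s, z, hz, hs⟩ := grp_gen p hp F Z hFcard hFab hZF hZcard ψ hψF hψZ (h⁻¹ * ψ * h)
      (by simpa using hFnorm.conj_mem ψ hψF h⁻¹)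
    refine ⟨s, z, hz, hs, fun hmod => ?_⟩
    rw [pow_eq_pow_of_modEq hmod hψp, pow_one] at hs
    exact grp_psi_frob F H Z hfrob hFab hFnorm hZF hZnorm ψ hψF hψZ h hh h1 z hz hs
  have hcancel : ∀ i r : ℕ, ¬ p ∣ i → i * r ≡ i [MOD p] → r ≡ 1 [MOD p] := by
    intro i r hi h
    have h' : i * r ≡ i * 1 [MOD p] := by simpa using h
    exact Nat.ModEq.cancel_left_of_coprime (hp.coprime_iff_not_dvd.2 hi) h'
  have hval : ∀ i : ZMod p, i ≠ 0 → ¬ p ∣ i.val := by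
    intro i hi hd
    have h1 := ZMod.val_lt i
    have h2 := Nat.eq_zero_of_dvd_of_lt hd h1
    exact hi ((ZMod.val_eq_zero i).1 h2)
  have hker : ∀ T : Submodule R L, ∀ n : ℕ, (∀ Q ∈ adM T ^ n, ∀ i, ∀ v ∈ Li i, Q v = 0) →
      adM T ^ n = ⊥ := by
    intro T n h
    rw [eq_bot_iff]
    intro Q hQ
    rw [Submodule.mem_bot]
    have : iSup Li ≤ LinearMap.ker Q := iSup_le fun i v hv => h Q hQ i v hv
    rw [htop, top_le_iff, LinearMap.ker_eq_top] at this
    exact this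
  have hfixKill : ∀ g ∈ F, g ≠ 1 → ∀ T : Submodule R L, (∀ y ∈ T, ρ g y = y) → ∀ v, ρ g v = v →
      ∀ Q ∈ adM T ^ (c + d), Q v = 0 := by
    intro g hg hg1 T hT v hv
    refine adM_pow_kill_mono T d (c + d) (by omega) v fun Q hQ => ?_
    have := adM_pow_apply_mem T (fixSub ρ {g} : Set L) (fixSub ρ {g} : Set L)
      (by rintro y hy g' rfl; exact hT y hy) v (by rintro g' rfl; exact hv) d Q hQ
    rw [hdF g hg hg1] at this
    exact this
  have hnilH : ∀ T : Submodule R L, T ≤ Li 0 → (∀ y ∈ T, ∀ h ∈ H, ρ h y = y) →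
      adM T ^ (c + d) = ⊥ := by
    intro T hT0 hTH
    apply hker
    intro Q hQ i v hv
    by_cases hi : i = 0
    · subst hi
      exact hfixKill φ hφF hφ1 T (fun y hy => (hL0 y).1 (hT0 hy)) v ((hL0 v).1 hv) Q hQ
    · refine adM_pow_kill_mono T c (c + d) (by omega) v (fun Q hQ => ?_) Q hQ
      have hyi : Q v ∈ Li i :=
        adM_pow_apply_mem_sub T (Li i) (fun y hy x hx => hLie i y (hT0 hy) x hx) v hv c Q hQ
      have hX : (∑ h : H, ρ h v) ∈ (fixSub ρ (H : Set A) : Set L) := by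
        intro g hg
        rw [map_sum]
        simp only [← hρmul]
        exact Fintype.sum_equiv (Equiv.mulLeft (⟨g, hg⟩ : H)) _ _ (fun x => rfl)
      have h0 : Q (∑ h : H, ρ h v) = 0 := by
        have := adM_pow_apply_mem T (fixSub ρ (H : Set A) : Set L) (fixSub ρ (H : Set A) : Set L)
          (fun y hy g hg => hTH y hy g hg) _ hX c Q hQ
        rw [hcH] at this
        exact this
      have h1 : ∑ h : H, ρ h (Q v) = 0 := by
        rw [← h0, map_sum]
        exact Finset.sum_congr rfl fun h _ =>
          (adM_pow_comm T (ρ h) (fun y hy => hTH y hy h h.2) v c Q hQ).symm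
      have h2 := orbit_proj ρ p hp ω hωp hsum hρone hρmul H φ (Q v) i.val ((hEig _ _).1 hyi) (by
        intro h hh h1
        obtain ⟨r, hr, hr1⟩ := hφh h hh h1
        refine ⟨i.val * r, ?_, fun hm => hr1 (hcancel _ _ (hval i hi) hm)⟩
        rw [hmove, hr, rho_pow_eig ρ hρone hρmul ω φ (Q v) i.val ((hEig _ _).1 hyi), map_smul])
      rw [h1] at h2
      simp only [map_zero, smul_zero, Finset.sum_const_zero] at h2
      exact (hpu.smul_eq_zero).1 h2.symm
  have hnil00 : ∀ T : Submodule R L, T ≤ Li 0 → (∀ y ∈ T, ρ ψ y = y) →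
      adM T ^ (c + d) = ⊥ := by
    intro T hT0 hTψ
    apply hker
    intro Q hQ i
    have hcommφψ : ψ⁻¹ * φ * ψ = φ := by
      rw [mul_assoc, hFab φ hφF ψ hψF]; group
    have : Li i ≤ LinearMap.ker Q := by
      refine weight_ind ρ p hp ω hωp hpu hsum hρone hρmul ψ hψp (Li i) _ ?_ ?_
      · intro x hx
        rw [hEig] at hx ⊢
        rw [hmove, hcommφψ, hx, map_smul]
      · intro j v hv hj
        rw [LinearMap.mem_ker]
        by_cases hi : i = 0
        · subst hi
          exact hfixKill φ hφF hφ1 T (fun y hy => (hL0 y).1 (hT0 hy)) v ((hL0 v).1 hv) Q hQ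
        · obtain ⟨b, -, hb⟩ := Nat.exists_mul_mod_eq_one_of_coprime
            ((hp.coprime_iff_not_dvd.2 (hval i hi)).symm) hp.one_lt
          have hb' : i.val * b ≡ 1 [MOD p] := by
            rw [Nat.ModEq, hb, Nat.mod_eq_of_lt hp.one_lt]
          set a := b * ((p - 1) * j) with ha
          have hdvd : p ∣ i.val * a + j := by
            rw [← Nat.modEq_zero_iff_dvd]
            have e1 : i.val * a + j = (i.val * b) * ((p - 1) * j) + j := by rw [ha]; ring
            have e2 : 1 * ((p - 1) * j) + j = p * j := by
              obtain ⟨m, hm⟩ : ∃ m, p = m + 1 := ⟨p - 1, by have := hp.pos; omega⟩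
              rw [hm]; simp; ring
            rw [e1]
            refine ((hb'.mul_right _).add_right j).trans ?_
            rw [e2, Nat.modEq_zero_iff_dvd]
            exact dvd_mul_right p j
          refine hfixKill (φ ^ a * ψ) (F.mul_mem (F.pow_mem hφF a) hψF) ?_ T ?_ v ?_ Q hQ
          · intro h
            apply hψZ
            rw [← inv_eq_of_mul_eq_one_right h]
            exact Z.inv_mem (Z.pow_mem hφZ a)
          · intro y hy
            rw [hρmul, hTψ y hy, hZfix _ (Z.pow_mem hφZ a) y (hT0 hy)]
          · rw [hρmul, hj, map_smul,
              rho_pow_eig ρ hρone hρmul ω φ v i.val ((hEig _ _).1 hv), smul_smul, ← pow_add]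
            obtain ⟨m, hm⟩ := hdvd
            rw [add_comm, hm, pow_mul, hωp, one_pow, one_smul]
    exact fun v hv => this hv
  -- the decomposition of an invariant submodule of `Li 0`
  have hdecomp : ∀ M : Submodule R L, M ≤ Li 0 → (∀ g, ∀ x ∈ M, ρ g x ∈ M) →
      ∀ P : Submodule R L, (M ⊓ fixSub ρ {ψ} ≤ P) →
      (∀ k < p, ∀ y ∈ M ⊓ fixSub ρ (H : Set A), ρ (ψ ^ k) y ∈ P) → M ≤ P := by
    intro M hM0 hMinv P hP0 hPk
    refine weight_ind ρ p hp ω hωp hpu hsum hρone hρmul ψ hψp M P (hMinv ψ) ?_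
    intro j y hy hj
    by_cases hpj : p ∣ j
    · apply hP0
      refine ⟨hy, ?_⟩
      rintro g rfl
      obtain ⟨m, rfl⟩ := hpj
      rw [hj, pow_mul, hωp, one_pow, one_smul]
    · have h2 := orbit_proj ρ p hp ω hωp hsum hρone hρmul H ψ y j hj (by
        intro h hh h1
        obtain ⟨s, z, hz, hs, hs1⟩ := hψh h hh h1
        refine ⟨j * s, ?_, fun hm => hs1 (hcancel _ _ hpj hm)⟩
        rw [hmove, hs, hρmul, hZfix z hz y (hM0 hy),
          rho_pow_eig ρ hρone hρmul ω ψ y j hj, map_smul])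
      have h3 : (p : R) • y ∈ P := by
        rw [← h2]
        refine Submodule.sum_mem _ fun k hk => Submodule.smul_mem _ _
          (hPk k (Finset.mem_range.1 hk) _ ⟨Submodule.sum_mem _ fun h _ => hMinv _ _ hy, ?_⟩)
        intro g hg
        rw [map_sum]
        simp only [← hρmul]
        exact Fintype.sum_equiv (Equiv.mulLeft (⟨g, hg⟩ : H)) _ _ (fun x => rfl)
      exact (Submodule.smul_mem_iff_of_isUnit P hpu).1 h3
  -- the lower central series of `Li 0`
  set γ : ℕ → Submodule R L := iterBra R (Li 0 : Set L) (Li 0 : Set L) with hγ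
  have hγ0 : γ 0 = Li 0 := Submodule.span_eq (Li 0)
  have hγd : γ d = ⊥ := by
    rw [hγ, hL0set]; exact hdF φ hφF hφ1
  have hγlie : ∀ j, ∀ x ∈ γ j, ∀ y ∈ Li 0, ⁅x, y⁆ ∈ γ (j + 1) :=
    fun j x hx y hy => Submodule.subset_span ⟨x, hx, y, hy, rfl⟩
  have hγanti : ∀ j, γ (j + 1) ≤ γ j := by
    intro j
    induction j with
    | zero =>
      refine Submodule.span_le.2 ?_
      rintro _ ⟨x, hx, y, hy, rfl⟩
      have hx' : x ∈ γ 0 := hx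
      rw [hγ0] at hx'
      rw [SetLike.mem_coe, hγ0]
      exact hLie 0 x hx' y hy
    | succ j ih =>
      refine Submodule.span_le.2 ?_
      rintro _ ⟨x, hx, y, hy, rfl⟩
      exact hγlie j x (ih hx) y hy
  have hγle : ∀ j, γ j ≤ Li 0 := by
    intro j
    induction j with
    | zero => exact hγ0.le
    | succ j ih => exact (hγanti j).trans ih
  have hγinv : ∀ j, ∀ g, ∀ x ∈ γ j, ρ g x ∈ γ j := by
    intro j g
    induction j with
    | zero => rw [hγ0]; exact hL0inv g
    | succ j ih =>
      suffices h : γ (j + 1) ≤ (γ (j + 1)).comap ((ρ g).toLinearEquiv : L →ₗ[R] L) from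
        fun x hx => h hx
      refine Submodule.span_le.2 ?_
      rintro _ ⟨x, hx, y, hy, rfl⟩
      change ρ g ⁅x, y⁆ ∈ γ (j + 1)
      rw [LieEquiv.map_lie]
      exact hγlie j _ (ih x hx) _ (hL0inv g y hy)
  have hmain : ∀ k, k ≤ d → adM (γ (d - k)) ^ (((p + 1) * (c + d) + 1) ^ k) = ⊥ := by
    intro k
    induction k with
    | zero =>
      intro _
      rw [Nat.sub_zero, hγd, pow_zero, pow_one, adM, Submodule.map_bot]
    | succ k ih =>
      intro hk
      have ih' := ih (by omega)
      have hj : d - k = (d - (k + 1)) + 1 := by omega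
      set j := d - (k + 1) with hjdef
      rw [hj] at ih'
      rw [pow_succ' ((p + 1) * (c + d) + 1) k]
      let Fam : ℕ → Submodule R L := fun t => match t with
        | 0 => γ j ⊓ fixSub ρ {ψ}
        | t + 1 => (γ j ⊓ fixSub ρ (H : Set A)).map ((ρ (ψ ^ t)).toLinearEquiv : L →ₗ[R] L)
      refine sub_step (adM (γ j)) (adM (γ (j + 1))) (Submodule.map_mono (hγanti j)) ?_ _ ih'
        (p + 1) (c + d) (fun t => adM (Fam t)) ?_ ?_ ?_
      · rintro _ ⟨x, hx, rfl⟩ _ ⟨y, hy, rfl⟩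
        have h1 : (LieAlgebra.ad R L x : Module.End R L) * LieAlgebra.ad R L y -
            LieAlgebra.ad R L y * LieAlgebra.ad R L x = LieAlgebra.ad R L ⁅x, y⁆ := by
          ext w
          change ⁅x, ⁅y, w⁆⁆ - ⁅y, ⁅x, w⁆⁆ = ⁅⁅x, y⁆, w⁆
          rw [lie_lie]
        have h2 := mem_adM (hγlie j x hx y (hγle j hy))
        rw [← h1] at h2
        exact h2
      · intro t
        apply Submodule.map_mono
        match t with
        | 0 => exact inf_le_left
        | t + 1 =>
          rintro _ ⟨y, hy, rfl⟩
          exact hγinv j _ y hy.1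
      · intro t
        match t with
        | 0 => exact hnil00 _ (inf_le_left.trans (hγle j)) (fun y hy => hy.2 ψ rfl)
        | t + 1 =>
          refine adM_pow_map (γ j ⊓ fixSub ρ (H : Set A)) (ρ (ψ ^ t)) _ ?_ _
            (hnilH _ (inf_le_left.trans (hγle j)) (fun y hy h hh => hy.2 h hh))
          rintro _ ⟨y, hy, rfl⟩
          exact ⟨y, hy, rfl⟩
      · have hle : ∀ t < p + 1, Fam t ≤ ((Finset.range (p + 1)).sup (fun t => adM (Fam t))).comap
            (LieAlgebra.ad R L : L →ₗ[R] Module.End R L) := by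
          intro t ht
          rw [← Submodule.map_le_iff_le_comap]
          exact Finset.le_sup (f := fun t => adM (Fam t)) (Finset.mem_range.2 ht)
        rw [adM, Submodule.map_le_iff_le_comap]
        refine hdecomp (γ j) (hγle j) (hγinv j) _ (hle 0 (by omega)) ?_
        intro k hk y hy
        exact hle (k + 1) (by omega) ⟨y, hy, rfl⟩
  have hfin := hmain d le_rfl
  rw [Nat.sub_self, hγ0] at hfin
  exact iterBra_univ_eq_bot (Li 0) _ hfin
end

section
/- For every prime p and all positive integers q, c, d there exists a number v = v(c,d,p,q) with the following property: under the standing setup, if L is metabelian (i.e., [[L,L],[L,L]] = 0), C_L(H) is nilpotent of class at most c and C_L(x) is nilpotent of class at most d for every nontrivial x ∈ F, then for every a ∈ ℤ/pℤ, [[L,L] ∩ L_0, L_a, …, L_a] = 0, where L_a occurs v times in the iterated bracket. -/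
set_option linter.unusedSectionVars false

section PredLemmas
variable {Q : Type*} [CommSemiring Q] (P : Q → Prop)

lemma mbb_add (h0 : P 0) (hadd : ∀ x y, P x → P y → P (x + y)) (hmul : ∀ x y, P x → P (x * y))
    (c x y : Q) (a b N : ℕ) (hN : a + b ≤ N + 1) (hx : P (c * x ^ a)) (hy : P (c * y ^ b)) :
    P (c * (x + y) ^ N) := by
  rw [add_pow, Finset.mul_sum]
  refine Finset.sum_induction _ P (fun a b => hadd a b) h0 ?_
  intro k hk
  have hk' : k ≤ N := Nat.lt_succ_iff.mp (Finset.mem_range.mp hk)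
  rcases le_or_gt a k with h | h
  · have : c * (x ^ k * y ^ (N - k) * (N.choose k : Q))
        = (c * x ^ a) * (x ^ (k - a) * y ^ (N - k) * (N.choose k : Q)) := by
      obtain ⟨j, rfl⟩ := Nat.exists_eq_add_of_le h
      rw [Nat.add_sub_cancel_left, pow_add]; ring
    rw [this]; exact hmul _ _ hx
  · have hb : b ≤ N - k := by omega
    have : c * (x ^ k * y ^ (N - k) * (N.choose k : Q))
        = (c * y ^ b) * (y ^ (N - k - b) * x ^ k * (N.choose k : Q)) := by
      obtain ⟨j, hj⟩ := Nat.exists_eq_add_of_le hb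
      rw [hj, Nat.add_sub_cancel_left, pow_add]; ring
    rw [this]; exact hmul _ _ hy

lemma mbb_sum (h0 : P 0) (hadd : ∀ x y, P x → P y → P (x + y)) (hmul : ∀ x y, P x → P (x * y))
    {ι : Type*} (s : Finset ι) (c : Q) (f : ι → Q) (n : ℕ) (hf : ∀ i ∈ s, P (c * f i ^ n)) :
    ∀ N, s.card * n + 1 ≤ N → P (c * (∑ i ∈ s, f i) ^ N) := by
  classical
  induction s using Finset.induction_on with
  | empty =>
    intro N hN
    rw [Finset.sum_empty, zero_pow (by omega), mul_zero]; exact h0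
  | insert i s hi ih =>
    intro N hN
    rw [Finset.sum_insert hi]
    rw [Finset.card_insert_of_notMem hi] at hN
    refine mbb_add P h0 hadd hmul c _ _ n (s.card * n + 1) N ?_ (hf i (by simp))
      (ih (fun j hj => hf j (by simp [hj])) _ le_rfl)
    nlinarith
end PredLemmas

/-- The data used in the core argument. -/
structure MbbData (p c d : ℕ) (R E Hι S V M : Type*) [CommRing R] [AddCommGroup E]
    [Module (ZMod p) E] [Fintype Hι] [CommRing S] [Algebra R S] [AddCommGroup V] [Module R V]
    [AddCommGroup M] [Module R M] [Module S M] [IsScalarTower R S M] where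
  w : ZMod p → R
  w0 : w 0 = 1
  wadd : ∀ a b, w (a + b) = w a * w b
  pu : IsUnit (p : R)
  cardE : Nat.card E = p ^ 2
  o : Hι
  cj : Hι → E ≃ₗ[ZMod p] E
  cjfree : ∀ h, h ≠ o → ∀ e, cj h e = e → e = 0
  cjo : ∀ e, cj o e = e
  t : V →ₗ[R] S
  tV : E → V →ₗ[R] V
  tM : E → M →ₗ[R] M
  sV : Hι → V →ₗ[R] V
  sM : Hι → M →ₗ[R] M
  tV0 : ∀ x, tV 0 x = x
  tM0 : ∀ x, tM 0 x = x
  tVadd : ∀ a b x, tV (a + b) x = tV a (tV b x)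
  tMadd : ∀ a b x, tM (a + b) x = tM a (tM b x)
  sVo : ∀ x, sV o x = x
  sMo : ∀ x, sM o x = x
  sVt : ∀ h e x, sV h (tV e x) = tV (cj h e) (sV h x)
  sMt : ∀ h e x, sM h (tM e x) = tM (cj h e) (sM h x)
  compt : ∀ e x m, tM e (t x • m) = t (tV e x) • tM e m
  comps : ∀ h x m, sM h (t x • m) = t (sV h x) • sM h m
  injV : ∀ k, k ≠ 0 → ∀ x : V, w k • x = x → x = 0
  injM : ∀ k, k ≠ 0 → ∀ x : M, w k • x = x → x = 0
  hypF : ∀ e, e ≠ 0 → ∀ m, tM e m = m →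
    ∀ s ∈ (Submodule.map t (LinearMap.ker (tV e - LinearMap.id))) ^ d, s • m = 0
  hypH : ∀ m, ∀ s ∈ (Submodule.map (t ∘ₗ ∑ h, sV h) ⊤) ^ c, s • (∑ h, sM h m) = 0

namespace MbbData
variable {p c d : ℕ} {R E Hι S V M : Type*} [CommRing R] [AddCommGroup E]
    [Module (ZMod p) E] [Fintype Hι] [CommRing S] [Algebra R S] [AddCommGroup V] [Module R V]
    [AddCommGroup M] [Module R M] [Module S M] [IsScalarTower R S M]

/-- Elements of `S` annihilating `N`. -/
def kill (R : Type*) {S M : Type*} [CommRing R] [CommRing S] [Algebra R S]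
    [AddCommGroup M] [Module R M] [Module S M] [IsScalarTower R S M] (N : Set M) :
    Submodule R S where
  carrier := {s | ∀ m ∈ N, s • m = 0}
  add_mem' := by
    intro a b ha hb m hm
    rw [add_smul, ha m hm, hb m hm, add_zero]
  zero_mem' := fun m _ => zero_smul _ m
  smul_mem' := by
    intro r x hx m hm
    rw [smul_assoc, hx m hm, smul_zero]

lemma sc (r : R) (a : S) (m : M) : a • r • m = r • a • m := by
  rw [← algebraMap_smul S r m, ← algebraMap_smul S r (a • m), ← mul_smul, ← mul_smul, mul_comm]

lemma mem_kill {N : Set M} {s : S} : s ∈ kill R N ↔ ∀ m ∈ N, s • m = 0 := Iff.rfl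

lemma kill_zero (N : Set M) : (0 : Submodule R S) ≤ kill R N := bot_le

lemma kill_add (N : Set M) (X Y : Submodule R S) (hX : X ≤ kill R N) (hY : Y ≤ kill R N) :
    X + Y ≤ kill R N := sup_le hX hY

lemma kill_mul (N : Set M) (X Y : Submodule R S) (hX : X ≤ kill R N) :
    X * Y ≤ kill R N := by
  rw [Submodule.mul_le]
  intro a ha b hb m hm
  rw [mul_comm, mul_smul, hX ha m hm, smul_zero]

lemma kill_mono {N : Set M} {X : Submodule R S} (hX : X ≤ kill R (Set.univ : Set M)) :
    X ≤ kill R N := fun _ hs m _ => hX hs m trivial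

section
variable [Fact p.Prime] [Finite E] (D : MbbData p c d R E Hι S V M)

/-- weight spaces -/
def wV (χ : Module.Dual (ZMod p) E) : Submodule R V where
  carrier := {x | ∀ e, D.tV e x = D.w (χ e) • x}
  add_mem' := by
    intro a b ha hb e
    rw [map_add, ha e, hb e, smul_add]
  zero_mem' := by intro e; simp
  smul_mem' := by
    intro r x hx e
    rw [map_smul, hx e, smul_comm]

/-- weight spaces -/
def wM (χ : Module.Dual (ZMod p) E) : Submodule R M where
  carrier := {x | ∀ e, D.tM e x = D.w (χ e) • x}
  add_mem' := by
    intro a b ha hb e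
    rw [map_add, ha e, hb e, smul_add]
  zero_mem' := by intro e; simp
  smul_mem' := by
    intro r x hx e
    rw [map_smul, hx e, smul_comm]

lemma mem_wV {χ : Module.Dual (ZMod p) E} {x : V} :
    x ∈ D.wV χ ↔ ∀ e, D.tV e x = D.w (χ e) • x := Iff.rfl
lemma mem_wM {χ : Module.Dual (ZMod p) E} {x : M} :
    x ∈ D.wM χ ↔ ∀ e, D.tM e x = D.w (χ e) • x := Iff.rfl

def T (χ : Module.Dual (ZMod p) E) : Submodule R S := (D.wV χ).map D.t

def act (h : Hι) (χ : Module.Dual (ZMod p) E) : Module.Dual (ZMod p) E :=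
  χ ∘ₗ (D.cj h).symm.toLinearMap

lemma act_apply (h : Hι) (χ : Module.Dual (ZMod p) E) (e : E) :
    D.act h χ e = χ ((D.cj h).symm e) := rfl

lemma act_o (χ : Module.Dual (ZMod p) E) : D.act D.o χ = χ := by
  ext e
  rw [act_apply]
  congr 1
  rw [LinearEquiv.symm_apply_eq, D.cjo]

/-! linear algebra -/

lemma wmulneg (a : ZMod p) : D.w a * D.w (-a) = 1 := by
  rw [← D.wadd, add_neg_cancel, D.w0]

lemma span2 (D : MbbData p c d R E Hι S V M) (f g : E) (χ : Module.Dual (ZMod p) E) (hf : f ≠ 0) (hχf : χ f = 0) (hg : χ g ≠ 0) :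
    ∀ e, ∃ a b : ZMod p, e = a • f + b • g := by
  have hinj : Function.Injective (fun ab : ZMod p × ZMod p => ab.1 • f + ab.2 • g) := by
    intro x y hxy
    simp only at hxy
    have h1 : (x.1 - y.1) • f + (x.2 - y.2) • g = 0 := by
      rw [sub_smul, sub_smul]
      have := sub_eq_zero.mpr hxy
      rw [← this]; abel
    have h2 := congrArg χ h1
    rw [map_add, map_smul, map_smul, hχf, map_zero, smul_zero, zero_add, smul_eq_mul] at h2
    have h3 : x.2 - y.2 = 0 := (mul_eq_zero.mp h2).resolve_right hg
    rw [h3, zero_smul, add_zero] at h1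
    have h4 := (smul_eq_zero.mp h1).resolve_right hf
    exact Prod.ext (sub_eq_zero.mp h4) (sub_eq_zero.mp h3)
  have hc : Nat.card (ZMod p × ZMod p) = Nat.card E := by
    rw [D.cardE, Nat.card_prod, Nat.card_zmod, sq]
  have hbij := (Nat.bijective_iff_injective_and_card _).mpr ⟨hinj, hc⟩
  intro e
  obtain ⟨ab, h⟩ := hbij.2 e
  exact ⟨ab.1, ab.2, h.symm⟩

lemma exists_ker (D : MbbData p c d R E Hι S V M) (χ : Module.Dual (ZMod p) E) : ∃ f : E, f ≠ 0 ∧ χ f = 0 := by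
  by_contra hcon
  push Not at hcon
  have hinj : Function.Injective χ := by
    rw [injective_iff_map_eq_zero]
    intro a ha
    by_contra h
    exact hcon a h ha
  have := Nat.card_le_card_of_injective _ hinj
  rw [D.cardE, Nat.card_zmod] at this
  have hp : 2 ≤ p := (Fact.out : p.Prime).two_le
  nlinarith

lemma exists_ne (_D : MbbData p c d R E Hι S V M) (χ : Module.Dual (ZMod p) E) (h : χ ≠ 0) : ∃ g : E, χ g ≠ 0 := by
  by_contra hcon
  push Not at hcon
  exact h (LinearMap.ext hcon)

lemma solve (D : MbbData p c d R E Hι S V M) (χ χ' θ : Module.Dual (ZMod p) E) (f : E) (hχ : χ ≠ 0) (hf : f ≠ 0) (hχf : χ f = 0)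
    (hχ' : χ' f ≠ 0) : ∃ i j : ℕ, i < p ∧ j < p ∧ θ + i • χ + j • χ' = 0 := by
  obtain ⟨g, hg⟩ := D.exists_ne χ hχ
  let b : ZMod p := -(θ f) / χ' f
  let a : ZMod p := -(θ g + b * χ' g) / χ g
  refine ⟨a.val, b.val, ZMod.val_lt _, ZMod.val_lt _, ?_⟩
  apply LinearMap.ext
  intro e
  have key : ∀ e, (θ + a.val • χ + b.val • χ') e = θ e + a * χ e + b * χ' e := by
    intro e
    simp [nsmul_eq_mul]
  obtain ⟨x, y, rfl⟩ := D.span2 f g χ hf hχf hg e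
  rw [map_add, map_smul, map_smul, key, key, hχf]
  have e1 : θ f + a * 0 + b * χ' f = 0 := by
    simp only [b]; field_simp; ring
  have e2 : θ g + a * χ g + b * χ' g = 0 := by
    simp only [a]; field_simp; ring
  rw [e1, e2]; simp

/-! orthogonality -/
lemma card_dual (D : MbbData p c d R E Hι S V M) : Nat.card (Module.Dual (ZMod p) E) = p ^ 2 := by
  have h1 : Nat.card E = Nat.card (ZMod p) ^ Module.finrank (ZMod p) E :=
    Module.natCard_eq_pow_finrank
  have h2 : Nat.card (Module.Dual (ZMod p) E)
      = Nat.card (ZMod p) ^ Module.finrank (ZMod p) (Module.Dual (ZMod p) E) :=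
    Module.natCard_eq_pow_finrank
  rw [h2, Subspace.dual_finrank_eq, ← h1, D.cardE]

/-- a sum invariant under translation vanishes -/
lemma orth {G W : Type*} [AddCommGroup G] [Fintype G] [AddCommGroup W] [Module R W]
    (inj : ∀ k, k ≠ 0 → ∀ x : W, D.w k • x = x → x = 0) (f : G →+ ZMod p) (g : G) (hg : f g ≠ 0)
    (x : W) : ∑ a, D.w (f a) • x = 0 := by
  apply inj _ hg
  rw [Finset.smul_sum]
  rw [← Equiv.sum_comp (Equiv.addLeft g) (fun a => D.w (f a) • x)]
  refine Finset.sum_congr rfl fun a _ => ?_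
  rw [smul_smul, ← D.wadd, Equiv.coe_addLeft, map_add]

lemma pcancel (D : MbbData p c d R E Hι S V M) {W : Type*} [AddCommGroup W] [Module R W] (n : ℕ) (x : W) (h : p ^ n • x = 0) :
    x = 0 := by
  have h1 : ((p : R) ^ n) • x = 0 := by
    rw [← h, ← Nat.cast_pow, Nat.cast_smul_eq_nsmul]
  exact (D.pu.pow n).smul_eq_zero.mp h1


/-! decomposition -/
lemma decomp {W : Type*} [AddCommGroup W] [Module R W]
    (inj : ∀ k, k ≠ 0 → ∀ x : W, D.w k • x = x → x = 0)
    (τ : E → W →ₗ[R] W) (τ0 : ∀ x, τ 0 x = x) (τadd : ∀ a b x, τ (a + b) x = τ a (τ b x)) :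
    ∃ π : Module.Dual (ZMod p) E → W → W, (∀ χ x e, τ e (π χ x) = D.w (χ e) • π χ x) ∧
      ∀ [Fintype (Module.Dual (ZMod p) E)] x, ∑ χ, π χ x = p ^ 2 • x := by
  classical
  have := Fintype.ofFinite E
  refine ⟨fun χ x => ∑ e, D.w (-χ e) • τ e x, ?_, ?_⟩
  · intro χ x e
    simp only [map_sum, map_smul, Finset.smul_sum]
    rw [← Equiv.sum_comp (Equiv.addLeft e) (fun a => D.w (χ e) • D.w (-χ a) • τ a x)]
    refine Finset.sum_congr rfl fun a _ => ?_
    rw [Equiv.coe_addLeft, τadd, smul_smul, ← D.wadd]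
    congr 2
    rw [map_add]; ring
  · intro _ x
    rw [Finset.sum_comm, Finset.sum_eq_single (0 : E)]
    · simp only [map_zero, neg_zero, D.w0, τ0, one_smul, Finset.sum_const, Finset.card_univ]
      rw [← Nat.card_eq_fintype_card, D.card_dual]
    · intro e _ he
      obtain ⟨χ, hχ⟩ : ∃ χ : Module.Dual (ZMod p) E, χ e ≠ 0 := by
        by_contra hcon
        push Not at hcon
        exact he ((Module.forall_dual_apply_eq_zero_iff (ZMod p) e).mp hcon)
      let f : Module.Dual (ZMod p) E →+ ZMod p :=
        { toFun := fun χ => -χ e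
          map_zero' := by simp
          map_add' := by intro a b; simp; ring }
      exact D.orth inj f χ (by simpa [f] using hχ) (τ e x)
    · simp

lemma kill_univ_of (X : Submodule R S) (h : ∀ ψ, X ≤ kill R (D.wM ψ : Set M)) :
    X ≤ kill R (Set.univ : Set M) := by
  classical
  have : Finite (Module.Dual (ZMod p) E) :=
    Finite.of_injective (fun χ => (χ : E → ZMod p)) DFunLike.coe_injective
  have : Fintype (Module.Dual (ZMod p) E) := Fintype.ofFinite _
  obtain ⟨π, h1, h2⟩ := D.decomp D.injM D.tM D.tM0 D.tMadd
  intro s hs m _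
  apply D.pcancel 2
  rw [smul_comm, ← h2, Finset.smul_sum]
  exact Finset.sum_eq_zero fun χ _ => h χ hs _ (h1 χ m)

lemma top_le [Fintype (Module.Dual (ZMod p) E)] :
    Submodule.map D.t ⊤ ≤ ∑ χ, D.T χ := by
  classical
  obtain ⟨π, h1, h2⟩ := D.decomp D.injV D.tV D.tV0 D.tVadd
  rintro _ ⟨x, -, rfl⟩
  obtain ⟨u, hu⟩ := D.pu.pow 2
  have hx : x = (↑u⁻¹ : R) • ∑ χ, π χ x := by
    rw [h2, ← Nat.cast_smul_eq_nsmul R, Nat.cast_pow, ← hu, smul_smul, Units.inv_mul, one_smul]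
  rw [hx, map_smul, map_sum]
  refine Submodule.smul_mem _ _ (Submodule.sum_mem _ fun χ _ => ?_)
  have : D.T χ ≤ ∑ χ, D.T χ := Finset.single_le_sum (f := D.T) (fun _ _ => bot_le) (Finset.mem_univ χ)
  exact this ⟨_, h1 χ x, rfl⟩

/-! weights of products -/
lemma shift (χ ψ : Module.Dual (ZMod p) E) (i : ℕ) :
    ∀ s ∈ D.T χ ^ i, ∀ m ∈ D.wM ψ, s • m ∈ D.wM (ψ + i • χ) := by
  induction i with
  | zero =>
    intro s hs m hm
    rw [pow_zero, Submodule.mem_one] at hs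
    obtain ⟨r, rfl⟩ := hs
    rw [algebraMap_smul, zero_smul, add_zero]
    exact Submodule.smul_mem _ _ hm
  | succ i ih =>
    intro s hs m hm
    rw [pow_succ'] at hs
    refine Submodule.mul_induction_on hs ?_ ?_
    · rintro _ ⟨x, hx, rfl⟩ b hb
      have := ih b hb m hm
      rw [mul_smul]
      intro e
      rw [D.compt, this e, hx e, map_smul, smul_assoc, sc (D.w _) (D.t x), smul_smul, ← D.wadd]
      congr 2
      simp [add_smul]; ring
    · intro x y hx hy
      rw [add_smul x y m]; exact Submodule.add_mem _ hx hy

lemma dep (χ ψ : Module.Dual (ZMod p) E) (f : E) (hf : f ≠ 0) (h1 : χ f = 0) (h2 : ψ f = 0) :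
    D.T χ ^ d ≤ kill R (D.wM ψ : Set M) := by
  intro s hs m hm
  refine D.hypF f hf m ?_ s ?_
  · rw [hm f, h2, D.w0, one_smul]
  · refine (pow_le_pow_left' (?_ : D.T χ ≤ _) d) hs
    refine Submodule.map_mono ?_
    intro x hx
    rw [LinearMap.mem_ker, LinearMap.sub_apply, hx f, h1, D.w0, one_smul]; simp

lemma stepA (χ χ' : Module.Dual (ZMod p) E) (f : E) (hχ : χ ≠ 0) (hf : f ≠ 0) (hχf : χ f = 0)
    (hχ' : χ' f ≠ 0) : D.T χ ^ (p + d) * D.T χ' ^ (p + d) ≤ kill R (Set.univ : Set M) := by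
  apply D.kill_univ_of
  intro θ
  obtain ⟨i, j, hi, hj, hij⟩ := D.solve χ χ' θ f hχ hf hχf hχ'
  have : D.T χ ^ (p + d) * D.T χ' ^ (p + d)
      = (D.T χ ^ d * (D.T χ ^ (p - i) * D.T χ' ^ (p + d - j))) * (D.T χ' ^ j * D.T χ ^ i) := by
    have e1 : p + d = d + (p - i) + i := by omega
    have e2 : D.T χ' ^ (p + d) = D.T χ' ^ (p + d - j) * D.T χ' ^ j := by
      rw [← pow_add]; congr 1; omega
    have e3 : D.T χ ^ (p + d) = D.T χ ^ d * D.T χ ^ (p - i) * D.T χ ^ i := by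
      rw [← pow_add, ← pow_add]; congr 1
    rw [e2, e3]
    ring
  rw [this, Submodule.mul_le]
  intro a ha b hb m hm
  rw [mul_smul]
  have hb' : b • m ∈ D.wM 0 := by
    refine Submodule.mul_induction_on hb ?_ ?_
    · intro x hx y hy
      rw [mul_smul, ← hij]
      exact D.shift _ _ _ _ hx _ (D.shift _ _ _ _ hy _ hm)
    · intro x y hx hy
      rw [add_smul]; exact Submodule.add_mem _ hx hy
  exact kill_mul _ _ _ (D.dep χ 0 f hf hχf rfl) ha _ hb'

lemma T_zero : D.T 0 ^ d ≤ kill R (Set.univ : Set M) := by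
  apply D.kill_univ_of
  intro ψ
  obtain ⟨f, hf, h⟩ := D.exists_ker ψ
  exact D.dep 0 ψ f hf rfl h

/-! twisting -/
def Tw (σ : M →ₗ[R] M) (X Y : Submodule R S) : Prop :=
  ∀ s ∈ X, ∃ s' ∈ Y, ∀ m, σ (s • m) = s' • σ m

lemma Tw.mul {σ : M →ₗ[R] M} {X Y X' Y' : Submodule R S} (h : Tw σ X Y) (h' : Tw σ X' Y') :
    Tw σ (X * X') (Y * Y') := by
  intro s hs
  refine Submodule.mul_induction_on hs ?_ ?_
  · intro a ha b hb
    obtain ⟨a', ha', h1⟩ := h a ha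
    obtain ⟨b', hb', h2⟩ := h' b hb
    exact ⟨a' * b', Submodule.mul_mem_mul ha' hb', fun m => by rw [mul_smul, h1, h2, mul_smul]⟩
  · rintro a b ⟨a', ha', h1⟩ ⟨b', hb', h2⟩
    exact ⟨a' + b', Submodule.add_mem _ ha' hb', fun m => by
      rw [add_smul, map_add, h1, h2, add_smul]⟩

lemma Tw.pow {σ : M →ₗ[R] M} {X Y : Submodule R S} (h : Tw σ X Y) (n : ℕ) :
    Tw σ (X ^ n) (Y ^ n) := by
  induction n with
  | zero =>
    intro s hs
    refine ⟨s, by simpa using hs, fun m => ?_⟩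
    rw [pow_zero, Submodule.mem_one] at hs
    obtain ⟨r, rfl⟩ := hs
    rw [algebraMap_smul, algebraMap_smul, map_smul]
  | succ n ih =>
    rw [pow_succ, pow_succ]; exact ih.mul h

lemma sV_wV (h : Hι) (χ : Module.Dual (ZMod p) E) (x : V) (hx : x ∈ D.wV χ) :
    D.sV h x ∈ D.wV (D.act h χ) := by
  intro e
  have := D.sVt h ((D.cj h).symm e) x
  rw [LinearEquiv.apply_symm_apply] at this
  rw [← this, hx, map_smul, act_apply]

lemma sM_wM (h : Hι) (χ : Module.Dual (ZMod p) E) (x : M) (hx : x ∈ D.wM χ) :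
    D.sM h x ∈ D.wM (D.act h χ) := by
  intro e
  have := D.sMt h ((D.cj h).symm e) x
  rw [LinearEquiv.apply_symm_apply] at this
  rw [← this, hx, map_smul, act_apply]

lemma tw_s (h : Hι) (χ : Module.Dual (ZMod p) E) : Tw (D.sM h) (D.T χ) (D.T (D.act h χ)) := by
  rintro _ ⟨x, hx, rfl⟩
  exact ⟨D.t (D.sV h x), ⟨_, D.sV_wV h χ x hx, rfl⟩, fun m => D.comps h x m⟩

lemma tw_t (e : E) (W W' : Submodule R V) (h : ∀ x ∈ W, D.tV e x ∈ W') :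
    Tw (D.tM e) (W.map D.t) (W'.map D.t) := by
  rintro _ ⟨x, hx, rfl⟩
  exact ⟨D.t (D.tV e x), ⟨_, h x hx, rfl⟩, fun m => D.compt e x m⟩

/-- The part of `S` commuting with `tM (k • f)`. -/
lemma comm_pow (f : E) (X : Submodule R S)
    (hX : ∀ s ∈ X, ∀ k : ZMod p, ∀ m, D.tM (k • f) (s • m) = s • D.tM (k • f) m) (n : ℕ) :
    ∀ s ∈ X ^ n, ∀ k : ZMod p, ∀ m, D.tM (k • f) (s • m) = s • D.tM (k • f) m := by
  induction n with
  | zero =>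
    intro s hs k m
    rw [pow_zero, Submodule.mem_one] at hs
    obtain ⟨r, rfl⟩ := hs
    rw [algebraMap_smul, algebraMap_smul, map_smul]
  | succ n ih =>
    intro s hs k m
    rw [pow_succ] at hs
    refine Submodule.mul_induction_on hs ?_ ?_
    · intro a ha b hb
      rw [mul_smul, ih a ha, hX b hb, mul_smul]
    · intro a b ha hb
      rw [add_smul, map_add, ha, hb, add_smul]

lemma comm_t (f : E) (x : V) (hx : ∀ k : ZMod p, D.tV (k • f) x = x) (k : ZMod p) (m : M) :
    D.tM (k • f) (D.t x • m) = D.t x • D.tM (k • f) m := by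
  rw [D.compt, hx]

lemma indep [DecidableEq Hι] (f : E) (s : Finset Hι) (ho : D.o ∈ s) (v : Hι → M) (a : Hι → ZMod p)
    (hv : ∀ h ∈ s, ∀ k : ZMod p, D.tM (k • f) (v h) = D.w (k * a h) • v h)
    (ha : ∀ h ∈ s, h ≠ D.o → a h ≠ a D.o) (hsum : ∑ h ∈ s, v h = 0) : v D.o = 0 := by
  have key : ∑ h ∈ s, ∑ k : ZMod p, D.w (-(k * a D.o)) • D.tM (k • f) (v h) = 0 := by
    rw [Finset.sum_comm]
    refine Finset.sum_eq_zero fun k _ => ?_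
    rw [← Finset.smul_sum, ← map_sum, hsum, map_zero, smul_zero]
  rw [Finset.sum_eq_single D.o] at key
  · apply D.pcancel 1
    rw [← key, pow_one]
    have : ∀ k : ZMod p, D.w (-(k * a D.o)) • D.tM (k • f) (v D.o) = v D.o := by
      intro k
      rw [hv _ ho, smul_smul, ← D.wadd, neg_add_cancel, D.w0, one_smul]
    simp [this]
  · intro h hs hne
    have : ∀ k : ZMod p, D.w (-(k * a D.o)) • D.tM (k • f) (v h)
        = D.w ((AddMonoidHom.mulRight (a h - a D.o)) k) • v h := by
      intro k
      rw [hv _ hs, smul_smul, ← D.wadd]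
      congr 2
      simp; ring
    simp only [this]
    refine D.orth D.injM _ 1 ?_ _
    simpa [sub_eq_zero] using ha h hs hne
  · intro h; exact absurd ho h

lemma act_ne (χ : Module.Dual (ZMod p) E) (hχ : χ ≠ 0) (h : Hι) (hh : h ≠ D.o) :
    D.act h χ ≠ χ := by
  intro heq
  have hinj : Function.Injective (fun e : E => D.cj h e - e) := by
    intro a b hab
    simp only at hab
    have : D.cj h (a - b) = a - b := by
      rw [map_sub]
      have h1 : D.cj h a = D.cj h b + (a - b) := by
        rw [sub_eq_iff_eq_add] at hab; rw [hab]; abel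
      rw [h1]; abel
    exact sub_eq_zero.mp (D.cjfree h hh _ this)
  have hsurj := Finite.surjective_of_injective hinj
  apply hχ
  apply LinearMap.ext
  intro e
  obtain ⟨b, rfl⟩ := hsurj e
  have h1 := congrArg (fun θ : Module.Dual (ZMod p) E => θ (D.cj h b)) heq
  simp only [act_apply, LinearEquiv.symm_apply_apply] at h1
  simp only [map_sub, ← h1, sub_self, LinearMap.zero_apply]

lemma act_f (χ ψ : Module.Dual (ZMod p) E) (f : E) (hχ : χ ≠ 0) (hf : f ≠ 0) (hχf : χ f = 0)
    (h : Hι) (hh : h ≠ D.o) (h1 : D.act h χ f = 0) (hψ : ψ f ≠ 0) : D.act h ψ f ≠ ψ f := by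
  obtain ⟨g, hg⟩ := D.exists_ne χ hχ
  rw [act_apply] at h1 ⊢
  obtain ⟨a, b, hab⟩ := D.span2 f g χ hf hχf hg ((D.cj h).symm f)
  rw [hab, map_add, map_smul, map_smul, hχf, smul_zero, zero_add, smul_eq_mul] at h1
  have hb : b = 0 := (mul_eq_zero.mp h1).resolve_right hg
  rw [hb, zero_smul, add_zero] at hab
  rw [hab, map_smul, smul_eq_mul]
  intro heq
  have ha : a = 1 := by
    apply mul_right_cancel₀ hψ; rw [heq, one_mul]
  rw [ha, one_smul, LinearEquiv.symm_apply_eq] at hab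
  exact hf (D.cjfree h hh f hab.symm)


section main
variable [DecidableEq Hι]

/-- stabilizer of the line -/
def H1 (χ : Module.Dual (ZMod p) E) (f : E) : Finset Hι :=
  Finset.univ.filter fun h => D.act h χ f = 0

/-- the other ones -/
def H2 (χ : Module.Dual (ZMod p) E) (f : E) : Finset Hι :=
  Finset.univ.filter fun h => ¬ D.act h χ f = 0

def U1 (χ : Module.Dual (ZMod p) E) (f e : E) : Submodule R S :=
  ((D.wV χ).map (D.tV e ∘ₗ ∑ h ∈ D.H1 χ f, D.sV h)).map D.t

def EE (χ : Module.Dual (ZMod p) E) (f : E) : Submodule R S :=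
  ∑ h ∈ D.H2 χ f, D.T (D.act h χ)

lemma EE_kill (χ : Module.Dual (ZMod p) E) (f : E) (hχ : χ ≠ 0) (hf : f ≠ 0) (hχf : χ f = 0) :
    D.T χ ^ (p + d) * D.EE χ f ^ (Fintype.card Hι * (p + d) + 1) ≤ kill R (Set.univ : Set M) := by
  refine mbb_sum (fun X => X ≤ kill R (Set.univ : Set M)) (kill_zero _) (kill_add _) (kill_mul _)
    (D.H2 χ f) _ _ (p + d) ?_ _ ?_
  · intro h hh
    exact D.stepA χ _ f hχ hf hχf (Finset.mem_filter.mp hh).2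
  · have : (D.H2 χ f).card ≤ Fintype.card Hι := Finset.card_le_univ _
    have := Nat.mul_le_mul_right (p + d) this
    omega

lemma U1_le (χ : Module.Dual (ZMod p) E) (f : E) :
    D.U1 χ f 0 ≤ Submodule.map (D.t ∘ₗ ∑ h, D.sV h) ⊤ + D.EE χ f := by
  rintro _ ⟨_, ⟨x, hx, rfl⟩, rfl⟩
  have hsplit : (∑ h ∈ D.H1 χ f, D.sV h x) + (∑ h ∈ D.H2 χ f, D.sV h x) = ∑ h, D.sV h x :=
    Finset.sum_filter_add_sum_filter_not _ _ _
  have : D.t ((D.tV 0 ∘ₗ ∑ h ∈ D.H1 χ f, D.sV h) x)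
      = (D.t ∘ₗ ∑ h, D.sV h) x + - ∑ h ∈ D.H2 χ f, D.t (D.sV h x) := by
    simp only [LinearMap.comp_apply, LinearMap.sum_apply, D.tV0, ← map_sum, ← map_neg, ← map_add]
    rw [← hsplit]; congr 1; abel
  rw [this]
  refine Submodule.add_mem_sup ⟨x, trivial, rfl⟩ (Submodule.neg_mem _ (Submodule.sum_mem _ ?_))
  intro h hh
  have hle : D.T (D.act h χ) ≤ D.EE χ f :=
    Finset.single_le_sum (f := fun h => D.T (D.act h χ)) (fun _ _ => bot_le) hh
  exact hle ⟨_, D.sV_wV h χ x hx, rfl⟩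

lemma claim (χ ψ : Module.Dual (ZMod p) E) (f : E) (hχ : χ ≠ 0) (hf : f ≠ 0) (hχf : χ f = 0)
    (hψ : ψ f ≠ 0) (z z' : S) (hz : z ∈ D.T χ ^ (p + d)) (hz' : z' ∈ D.T χ ^ (p + d))
    (m : M) (hm : m ∈ D.wM ψ) (s : S)
    (hs : s ∈ D.U1 χ f 0 ^ (c + (Fintype.card Hι * (p + d) + 1))) : s • z' • z • m = 0 := by
  have hoH : D.o ∈ D.H1 χ f := by
    simp [H1, D.act_o, hχf]
  set wt : M := ∑ h ∈ D.H1 χ f, z' • D.sM h (z • m) with hwt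
  have hm1 := D.shift χ ψ _ z hz m hm
  -- the full sum equals the partial sum
  have hfull : z' • ∑ h, D.sM h (z • m) = wt := by
    rw [Finset.smul_sum, hwt]
    have := Finset.sum_filter_add_sum_filter_not Finset.univ (fun h => D.act h χ f = 0)
      (fun h => z' • D.sM h (z • m))
    rw [← this]
    change (∑ h ∈ D.H1 χ f, _) + (∑ h ∈ D.H2 χ f, _) = _
    rw [add_eq_left]
    refine Finset.sum_eq_zero fun h hh => ?_
    obtain ⟨z1, hz1, h1⟩ := (D.tw_s h χ).pow (p + d) z hz
    rw [h1, ← mul_smul]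
    exact D.stepA χ _ f hχ hf hχf (Finset.mem_filter.mp hh).2 (Submodule.mul_mem_mul hz' hz1) _
      trivial
  have k1 : (Submodule.map (D.t ∘ₗ ∑ h, D.sV h) ⊤) ^ c ≤ kill R ({wt} : Set M) := by
    rintro u hu _ rfl
    rw [← hfull, smul_comm, D.hypH _ u hu, smul_zero]
  have k2 : D.EE χ f ^ (Fintype.card Hι * (p + d) + 1) ≤ kill R ({wt} : Set M) := by
    rintro u hu _ rfl
    rw [← hfull, ← mul_smul, mul_comm]
    exact D.EE_kill χ f hχ hf hχf (Submodule.mul_mem_mul hz' hu) _ trivial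
  have k3 := mbb_add (fun X => X ≤ kill R ({wt} : Set M)) (kill_zero _) (kill_add _) (kill_mul _)
    1 (Submodule.map (D.t ∘ₗ ∑ h, D.sV h) ⊤) (D.EE χ f) c (Fintype.card Hι * (p + d) + 1)
    (c + (Fintype.card Hι * (p + d) + 1)) (Nat.le_succ _)
    (by rw [one_mul]; exact k1) (by rw [one_mul]; exact k2)
  rw [one_mul] at k3
  have hsw : s • wt = 0 := k3 (pow_le_pow_left' (D.U1_le χ f) _ hs) wt rfl
  rw [hwt, Finset.smul_sum] at hsw
  have hU : ∀ u ∈ D.U1 χ f 0, ∀ k : ZMod p, ∀ m, D.tM (k • f) (u • m) = u • D.tM (k • f) m := by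
    rintro _ ⟨_, ⟨x, hx, rfl⟩, rfl⟩ k m
    apply D.comm_t
    intro k
    simp only [LinearMap.comp_apply, LinearMap.sum_apply, D.tV0, map_sum]
    refine Finset.sum_congr rfl fun h hh => ?_
    rw [D.sV_wV h χ x hx, map_smul, (Finset.mem_filter.mp hh).2, smul_zero, D.w0, one_smul]
  have hT : ∀ u ∈ D.T χ, ∀ k : ZMod p, ∀ m, D.tM (k • f) (u • m) = u • D.tM (k • f) m := by
    rintro _ ⟨x, hx, rfl⟩ k m
    apply D.comm_t
    intro k
    rw [hx, map_smul, hχf, smul_zero, D.w0, one_smul]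
  have hψ' : (ψ + (p + d) • χ) f ≠ 0 := by
    simpa [hχf] using hψ
  have := D.indep f (D.H1 χ f) hoH (fun h => s • z' • D.sM h (z • m))
    (fun h => D.act h (ψ + (p + d) • χ) f) ?_ ?_ hsw
  · simpa only [D.sMo] using this
  · intro h _ k
    rw [D.comm_pow f _ hU _ s hs, D.comm_pow f _ hT _ z' hz', D.sM_wM h _ _ hm1,
      map_smul, smul_eq_mul, sc (D.w _) z', sc (D.w _) s]
  · intro h hh hne
    simp only [D.act_o]
    exact D.act_f χ _ f hχ hf hχf h hne (Finset.mem_filter.mp hh).2 hψ'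

lemma U1_kill (χ : Module.Dual (ZMod p) E) (f : E) (hχ : χ ≠ 0) (hf : f ≠ 0) (hχf : χ f = 0) :
    D.U1 χ f 0 ^ (c + (Fintype.card Hι * (p + d) + 1)) * (D.T χ ^ (p + d) * D.T χ ^ (p + d))
      ≤ kill R (Set.univ : Set M) := by
  apply D.kill_univ_of
  intro ψ
  by_cases hψ : ψ f = 0
  · have h1 := D.dep χ ψ f hf hχf hψ
    rw [mul_comm, mul_assoc, pow_add _ p d, mul_comm (D.T χ ^ p), mul_assoc]
    exact kill_mul _ _ _ h1
  · rw [Submodule.mul_le]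
    intro s hs z hz m hm
    rw [mul_smul]
    refine Submodule.mul_induction_on hz ?_ ?_
    · intro z' hz' z hz
      rw [mul_smul]
      exact D.claim χ ψ f hχ hf hχf hψ z z' hz hz' m hm s hs
    · intro a b ha hb
      rw [add_smul, smul_add, ha, hb, add_zero]

lemma U1_kill' (χ : Module.Dual (ZMod p) E) (f e : E) (hχ : χ ≠ 0) (hf : f ≠ 0) (hχf : χ f = 0) :
    D.U1 χ f e ^ (c + (Fintype.card Hι * (p + d) + 1)) * (D.T χ ^ (p + d) * D.T χ ^ (p + d))
      ≤ kill R (Set.univ : Set M) := by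
  have t1 : Tw (D.tM (-e)) (D.U1 χ f e) (D.U1 χ f 0) := by
    apply D.tw_t
    rintro _ ⟨x, hx, rfl⟩
    refine ⟨x, hx, ?_⟩
    simp only [LinearMap.comp_apply]
    rw [← D.tVadd, neg_add_cancel]
  have t2 : Tw (D.tM (-e)) (D.T χ) (D.T χ) := by
    apply D.tw_t
    intro x hx
    rw [hx]; exact Submodule.smul_mem _ _ hx
  have t3 := (t1.pow (c + (Fintype.card Hι * (p + d) + 1))).mul ((t2.pow (p + d)).mul (t2.pow (p + d)))
  intro s hs m _
  obtain ⟨s', hs', h⟩ := t3 s hs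
  have h0 : D.tM (-e) (s • m) = 0 := by
    rw [h]; exact D.U1_kill χ f hχ hf hχf hs' _ trivial
  have := congrArg (D.tM e) h0
  rwa [← D.tMadd, add_neg_cancel, D.tM0, map_zero] at this

lemma T_le [Fintype E] (χ : Module.Dual (ZMod p) E) (f : E) (hχ : χ ≠ 0) (hχf : χ f = 0) :
    D.T χ ≤ ∑ e, D.U1 χ f e := by
  have hoH : D.o ∈ D.H1 χ f := by
    simp [H1, D.act_o, hχf]
  rintro _ ⟨x, hx, rfl⟩
  obtain ⟨u, hu⟩ := D.pu.pow 2
  have key : ∑ e, D.w (-χ e) • ((D.tV e ∘ₗ ∑ h ∈ D.H1 χ f, D.sV h) x) = p ^ 2 • x := by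
    simp only [LinearMap.comp_apply, LinearMap.sum_apply, map_sum, Finset.smul_sum]
    rw [Finset.sum_comm, Finset.sum_eq_single D.o]
    · have : ∀ e, D.w (-χ e) • D.tV e (D.sV D.o x) = x := by
        intro e
        rw [D.sVo, hx, smul_smul, ← D.wadd, neg_add_cancel, D.w0, one_smul]
      simp only [this, Finset.sum_const, Finset.card_univ]
      rw [← Nat.card_eq_fintype_card, D.cardE]
    · intro h hh hne
      have : ∀ e, D.w (-χ e) • D.tV e (D.sV h x)
          = D.w ((D.act h χ - χ).toAddMonoidHom e) • D.sV h x := by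
        intro e
        rw [D.sV_wV h χ x hx, smul_smul, ← D.wadd]
        congr 2
        simp; ring
      simp only [this]
      obtain ⟨g, hg⟩ := D.exists_ne (D.act h χ - χ) (sub_ne_zero.mpr (D.act_ne χ hχ h hne))
      exact D.orth D.injV _ g hg _
    · intro h; exact absurd hoH h
  have hx : x = (↑u⁻¹ : R) • ∑ e, D.w (-χ e) • ((D.tV e ∘ₗ ∑ h ∈ D.H1 χ f, D.sV h) x) := by
    rw [key, ← Nat.cast_smul_eq_nsmul R, Nat.cast_pow, ← hu, smul_smul, Units.inv_mul, one_smul]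
  have hx' := hx
  rw [hx', map_smul, map_sum]
  refine Submodule.smul_mem _ _ (Submodule.sum_mem _ fun e _ => ?_)
  rw [map_smul]
  refine Submodule.smul_mem _ _ ?_
  have : D.U1 χ f e ≤ ∑ e, D.U1 χ f e :=
    Finset.single_le_sum (f := D.U1 χ f) (fun _ _ => bot_le) (Finset.mem_univ e)
  exact this ⟨_, ⟨x, by assumption, rfl⟩, rfl⟩

lemma T_kill (χ : Module.Dual (ZMod p) E) :
    D.T χ ^ (p ^ 2 * (c + (Fintype.card Hι * (p + d) + 1)) + 1 + ((p + d) + (p + d)))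
      ≤ kill R (Set.univ : Set M) := by
  have := Fintype.ofFinite E
  by_cases hχ : χ = 0
  · subst hχ
    rw [← add_assoc, ← add_assoc, pow_add _ _ d, mul_comm]
    exact kill_mul _ _ _ D.T_zero
  · obtain ⟨f, hf, hχf⟩ := D.exists_ker χ
    have h1 := mbb_sum (fun X => X ≤ kill R (Set.univ : Set M)) (kill_zero _) (kill_add _)
      (kill_mul _) Finset.univ (D.T χ ^ (p + d) * D.T χ ^ (p + d)) (D.U1 χ f)
      (c + (Fintype.card Hι * (p + d) + 1))
      (fun e _ => by rw [mul_comm]; exact D.U1_kill' χ f e hχ hf hχf)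
      (p ^ 2 * (c + (Fintype.card Hι * (p + d) + 1)) + 1)
      (by rw [Finset.card_univ, ← Nat.card_eq_fintype_card, D.cardE])
    refine le_trans ?_ h1
    rw [pow_add, pow_add _ (p + d), mul_comm]
    exact mul_le_mul_right (pow_le_pow_left' (D.T_le χ f hχ hχf) _) _

theorem core : (Submodule.map D.t ⊤) ^
    (p ^ 2 * (p ^ 2 * (c + (Fintype.card Hι * (p + d) + 1)) + 1 + ((p + d) + (p + d))) + 1)
      ≤ kill R (Set.univ : Set M) := by
  have : Finite (Module.Dual (ZMod p) E) :=
    Finite.of_injective (fun χ => (χ : E → ZMod p)) DFunLike.coe_injective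
  have : Fintype (Module.Dual (ZMod p) E) := Fintype.ofFinite _
  have h1 := mbb_sum (fun X => X ≤ kill R (Set.univ : Set M)) (kill_zero _) (kill_add _)
      (kill_mul _) Finset.univ 1 D.T _ (fun χ _ => by rw [one_mul]; exact D.T_kill χ) _
      (by rw [Finset.card_univ, ← Nat.card_eq_fintype_card, D.card_dual])
  rw [one_mul] at h1
  exact le_trans (pow_le_pow_left' D.top_le _) h1

end main
end
end MbbData

lemma mbb_exists_S.{u, v, x} {R : Type v} {M : Type u} {V : Type x} [CommRing R] [AddCommGroup M] [Module R M] [AddCommGroup V]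
    [Module R V] (t : V →ₗ[R] Module.End R M) (hcomm : ∀ x y, t x * t y = t y * t x) :
    ∃ (S : Type u) (_ : CommRing S) (_ : Algebra R S) (_ : Module S M) (_ : IsScalarTower R S M)
      (t' : V →ₗ[R] S), ∀ x m, t' x • m = t x m := by
  let S := Algebra.adjoin R (Set.range t)
  letI : CommRing S := Algebra.adjoinCommRingOfComm R (by
    rintro _ ⟨x, rfl⟩ _ ⟨y, rfl⟩; exact hcomm x y)
  refine ⟨S, inferInstance, inferInstance, inferInstance, ?_, ?_, ?_⟩
  · exact ⟨fun r s m => rfl⟩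
  · exact
      { toFun := fun x => ⟨t x, Algebra.subset_adjoin ⟨x, rfl⟩⟩
        map_add' := fun x y => Subtype.ext (map_add t x y)
        map_smul' := fun r x => Subtype.ext (map_smul t r x) }
  · intro x m; rfl

lemma mbb_exists_E.{u} {A : Type u} [Group A] (F H : Subgroup A) (hF : F.Normal)
    (hFab : ∀ f ∈ F, ∀ g ∈ F, f * g = g * f) :
    ∃ (E : Type u) (_ : AddCommGroup E) (τ : E → A) (cj : H → E ≃+ E),
      Nat.card E = Nat.card F ∧ (∀ e, τ e ∈ F) ∧ Function.Injective τ ∧ τ 0 = 1 ∧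
      (∀ a b, τ (a + b) = τ a * τ b) ∧ ∀ h e, τ (cj h e) = (h : A) * τ e * (h : A)⁻¹ := by
  let C : CommGroup F :=
    { (inferInstance : Group F) with
      mul_comm := fun a b => Subtype.ext (hFab a a.2 b b.2) }
  let c0 : H → F ≃* F := fun h => MulAut.conjNormal (h : A)
  refine ⟨Additive F, @Additive.addCommGroup F C, fun e => ((Additive.toMul e : F) : A),
    fun h => ⟨⟨fun e => Additive.ofMul (c0 h (Additive.toMul e)),
      fun e => Additive.ofMul ((c0 h).symm (Additive.toMul e)),
      fun e => (c0 h).symm_apply_apply _, fun e => (c0 h).apply_symm_apply _⟩,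
      fun a b => (c0 h).map_mul _ _⟩,
    rfl, fun e => (Additive.toMul e).2, ?_, rfl, fun a b => rfl, ?_⟩
  · intro a b hab
    exact Subtype.ext hab
  · intro h e
    exact MulAut.conjNormal_apply _ _

section bra
variable {R L : Type*} [CommRing R] [LieRing L] [LieAlgebra R L]

lemma mbb_mem_bra {S T : Set L} {x y : L} (hx : x ∈ S) (hy : y ∈ T) : ⁅x, y⁆ ∈ braSpan R S T :=
  Submodule.subset_span ⟨x, hx, y, hy, rfl⟩

lemma mbb_iter_mem {S : Type*} [CommRing S] [Algebra R S]
    (M : Submodule R L) [Module S M] [IsScalarTower R S M] (t : L →ₗ[R] S)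
    (ht : ∀ x (m : M), ((t x • m : M) : L) = ⁅(m : L), x⁆)
    (C : Set L) (W : Submodule R L) (hW : ∀ x ∈ W, x ∈ C) (m : M) (hm : (m : L) ∈ C) (n : ℕ) :
    ∀ s ∈ (W.map t) ^ n, ((s • m : M) : L) ∈ iterBra R C C n := by
  induction n with
  | zero =>
    intro s hs
    rw [pow_zero, Submodule.mem_one] at hs
    obtain ⟨r, rfl⟩ := hs
    rw [algebraMap_smul]
    exact Submodule.smul_mem _ r (Submodule.subset_span hm)
  | succ n ih =>
    intro s hs
    rw [pow_succ'] at hs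
    refine Submodule.mul_induction_on hs ?_ ?_
    · rintro _ ⟨x, hx, rfl⟩ b hb
      rw [mul_smul, ht]
      exact mbb_mem_bra (ih b hb) (hW x hx)
    · intro a b ha hb
      rw [add_smul]
      exact Submodule.add_mem _ ha hb

lemma mbb_final {S : Type*} [CommRing S] [Algebra R S]
    (M : Submodule R L) [Module S M] [IsScalarTower R S M] (t : L →ₗ[R] S)
    (ht : ∀ x (m : M), ((t x • m : M) : L) = ⁅(m : L), x⁆) (v : ℕ)
    (hv : (Submodule.map t ⊤) ^ v ≤ MbbData.kill R (Set.univ : Set M))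
    (S0 T0 : Set L) (hS : ∀ x ∈ S0, x ∈ M) : iterBra R S0 T0 v = ⊥ := by
  let K : ℕ → Submodule R M := fun j =>
    { carrier := {m | ∀ s ∈ (Submodule.map t ⊤) ^ j, s • m = 0}
      add_mem' := by
        intro a b ha hb s hs
        rw [smul_add, ha s hs, hb s hs, add_zero]
      zero_mem' := fun s _ => smul_zero s
      smul_mem' := by
        intro r m hm s hs
        rw [MbbData.sc r s m, hm s hs, smul_zero] }
  have key : ∀ n j, n + j = v → iterBra R S0 T0 n ≤ (K j).map M.subtype := by
    intro n
    induction n with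
    | zero =>
      intro j hj
      rw [zero_add] at hj
      subst hj
      change Submodule.span R S0 ≤ _
      rw [Submodule.span_le]
      intro x hx
      exact ⟨⟨x, hS x hx⟩, fun s hs => hv hs _ trivial, rfl⟩
    | succ n ih =>
      intro j hj
      change Submodule.span R _ ≤ _
      rw [Submodule.span_le]
      rintro _ ⟨x, hx, y, hy, rfl⟩
      obtain ⟨m, hm, rfl⟩ := ih (j + 1) (by omega) hx
      refine ⟨t y • m, ?_, ht y m⟩
      intro s hs
      rw [← mul_smul]
      refine hm _ ?_
      rw [pow_succ]
      exact Submodule.mul_mem_mul hs ⟨y, trivial, rfl⟩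
  rw [eq_bot_iff]
  refine (key v 0 (by simp)).trans ?_
  rintro _ ⟨m, hm, rfl⟩
  have : m = 0 := by
    have := hm 1 (by rw [pow_zero]; exact Submodule.one_le.mp le_rfl)
    rwa [one_smul] at this
  rw [this]; simp

lemma mbb_inj (p : ℕ) [Fact p.Prime] (ω : R) (w : ZMod p → R) (hw : ∀ k, w k = ω ^ k.val)
    (wadd : ∀ a b, w (a + b) = w a * w b) (e : L ≃ₗ⁅R⁆ L)
    (Li : ZMod p → Submodule R L) (hLi : ∀ i : ZMod p, Li i = eigSp e (ω ^ i.val))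
    (hdec : DirectSum.IsInternal Li) (k : ZMod p) (hk : k ≠ 0) (x : L) (hx : w k • x = x) :
    x = 0 := by
  obtain ⟨y, rfl⟩ := hdec.2 x
  have hy : w k • y = y := by
    apply hdec.1
    rw [← hx]
    exact (DirectSum.coeLinearMap Li).map_smul (w k) y
  have h0 : y = 0 := by
    refine DFinsupp.ext fun i => ?_
    have h1 : w k • y i = y i := by
      conv_rhs => rw [← hy]
      rfl
    have h1' : w k • (y i : L) = y i := congrArg Subtype.val h1
    have hmem : ((y i : Li i) : L) ∈ Li i := (y i).2
    have hmem2 : ((y i : Li i) : L) ∈ Li (i + k) := by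
      have h2 : ∀ z ∈ Li i, e z = ω ^ i.val • z := by
        intro z hz
        rw [hLi] at hz
        exact hz
      have h3 : ∀ z, e z = ω ^ (i + k).val • z → z ∈ Li (i + k) := by
        intro z hz
        rw [hLi]
        exact hz
      exact h3 _ (by rw [h2 _ (y i).2, ← hw, ← hw, wadd, mul_smul, h1'])
    have hd := hdec.submodule_iSupIndep.pairwiseDisjoint (show i ≠ i + k by simpa using hk)
    exact Subtype.ext (Submodule.disjoint_def.mp hd _ hmem hmem2)
  rw [h0]; exact map_zero _

end bra

theorem metabelian_bounded_bracket_of_derived_zero_component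
    (p q c d : ℕ) (hp : p.Prime) (hq : 0 < q) (hc : 0 < c) (hd : 0 < d) :
    ∃ v : ℕ, ∀
    (A : Type*) [Group A] [Finite A] (F H : Subgroup A)
    (hFnorm : F.Normal) (hFH : F ⊓ H = ⊥) (hFHtop : F ⊔ H = ⊤)
    (hFnt : F ≠ ⊥) (hHnt : H ≠ ⊥)
    (hfrob : ∀ x ∈ H, x ≠ 1 → ∀ f ∈ F, x * f = f * x → f = 1)
    (hss : IsSupersolvable A)
    (hFcard : Nat.card F = p ^ 2) (hFexp : ∀ f ∈ F, f ^ p = 1)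
    (hFab : ∀ f ∈ F, ∀ g ∈ F, f * g = g * f)
    (hHcard : Nat.card H = q) (hHcyc : IsCyclic H)
    (Z : Subgroup A) (hZF : Z ≤ F) (hZnorm : Z.Normal) (hZcard : Nat.card Z = p)
    (φ : A) (hφZ : φ ∈ Z) (hφgen : Z ≤ Subgroup.zpowers φ)
    (R : Type*) [CommRing R] [Finite R]
    (ω : R) (hω : IsPrimitiveRoot ω p) (hpu : IsUnit (p : R))
    (L : Type*) [LieRing L] [LieAlgebra R L]
    (ρ : A → (L ≃ₗ⁅R⁆ L))
    (hρone : ∀ x : L, ρ 1 x = x)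
    (hρmul : ∀ g₁ g₂ : A, ∀ x : L, ρ (g₁ * g₂) x = ρ g₁ (ρ g₂ x))
    (Li : ZMod p → Submodule R L)
    (hLi : ∀ i : ZMod p, Li i = eigSp (ρ φ) (ω ^ i.val))
    (hdec : DirectSum.IsInternal Li)
      (hmeta : braSpan R ((braSpan R Set.univ Set.univ : Submodule R L) : Set L)
        ((braSpan R Set.univ Set.univ : Submodule R L) : Set L) = ⊥)
      (hcH : iterBra R (fixSub ρ (H : Set A) : Set L)
        (fixSub ρ (H : Set A) : Set L) c = ⊥)
      (hdF : ∀ x ∈ F, x ≠ 1 →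
        iterBra R (fixSub ρ {x} : Set L) (fixSub ρ {x} : Set L) d = ⊥),
      ∀ a : ZMod p,
        iterBra R ((braSpan R Set.univ Set.univ ⊓ Li 0 : Submodule R L) : Set L)
          (Li a : Set L) v = ⊥ := by
  refine ⟨p ^ 2 * (p ^ 2 * (c + (q * (p + d) + 1)) + 1 + ((p + d) + (p + d))) + 1, ?_⟩
  intro A _ _ F H hFnorm hFH hFHtop hFnt hHnt hfrob hss hFcard hFexp hFab hHcard hHcyc Z hZF
    hZnorm hZcard φ hφZ hφgen R _ _ ω hω hpu L _ _ ρ hρone hρmul Li hLi hdec hmeta hcH hdF a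
  classical
  haveI : Fact p.Prime := ⟨hp⟩
  haveI := hFnorm
  obtain ⟨E, _, τ, cj0, hEc, τF, τinj, τ0, τadd, τcj⟩ := mbb_exists_E F H hFnorm hFab
  have τn : ∀ (n : ℕ) e, τ (n • e) = τ e ^ n := by
    intro n e
    induction n with
    | zero => simpa using τ0
    | succ n ih => rw [succ_nsmul, τadd, ih, pow_succ]
  obtain ⟨instMod⟩ : Nonempty (Module (ZMod p) E) := ⟨AddCommGroup.zmodModule (fun x => by
    apply τinj
    rw [τn, τ0, hFexp _ (τF x)])⟩
  have : Finite E := Nat.finite_of_card_ne_zero (by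
    rw [hEc, hFcard]
    exact pow_ne_zero _ hp.ne_zero)
  letI : Fintype H := Fintype.ofFinite H
  have hq' : Fintype.card H = q := by rw [← Nat.card_eq_fintype_card, hHcard]
  set M : Submodule R L := braSpan R Set.univ Set.univ with hM
  have hbr : ∀ x y : L, ⁅x, y⁆ ∈ M := fun x y => mbb_mem_bra trivial trivial
  have habel : ∀ x ∈ M, ∀ y ∈ M, ⁅x, y⁆ = 0 := by
    intro x hx y hy
    have : ⁅x, y⁆ ∈ (⊥ : Submodule R L) := hmeta ▸ mbb_mem_bra hx hy
    simpa using this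
  -- operators
  let t0 : L →ₗ[R] Module.End R M := LinearMap.mk₂ R (fun (x : L) (m : M) => (⟨⁅(m : L), x⁆, hbr _ _⟩ : M))
    (fun x y m => Subtype.ext (lie_add _ _ _))
    (fun r x m => Subtype.ext (lie_smul _ _ _))
    (fun x m m' => Subtype.ext (add_lie _ _ _))
    (fun r x m => Subtype.ext (smul_lie _ _ _))
  have hcomm : ∀ x y, t0 x * t0 y = t0 y * t0 x := by
    intro x y
    refine LinearMap.ext fun m => Subtype.ext ?_
    change ⁅⁅(m : L), y⁆, x⁆ = ⁅⁅(m : L), x⁆, y⁆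
    have h1 : ⁅(m : L), ⁅x, y⁆⁆ = 0 := habel _ m.2 _ (hbr _ _)
    rw [leibniz_lie, ← lie_skew x ⁅(m : L), y⁆, add_neg_eq_zero] at h1
    exact h1.symm
  obtain ⟨S, _, _, _, _, t, ht0⟩ := mbb_exists_S t0 hcomm
  have ht : ∀ x (m : M), ((t x • m : M) : L) = ⁅(m : L), x⁆ := by
    intro x m; rw [ht0]; rfl
  let rL : A → L →ₗ[R] L := fun g =>
    { toFun := ρ g
      map_add' := (ρ g).toLieHom.map_add
      map_smul' := (ρ g).toLieHom.map_smul }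
  have rLlie : ∀ g x y, rL g ⁅x, y⁆ = ⁅rL g x, rL g y⁆ := fun g x y => (ρ g).toLieHom.map_lie x y
  have rLmul : ∀ g g' x, rL (g * g') x = rL g (rL g' x) := hρmul
  have rLM : ∀ g, ∀ x ∈ M, rL g x ∈ M := by
    intro g x hx
    have : M ≤ M.comap (rL g) := by
      conv_lhs => rw [hM]
      refine Submodule.span_le.mpr ?_
      rintro _ ⟨x, -, y, -, rfl⟩
      change rL g ⁅x, y⁆ ∈ M
      rw [rLlie]; exact hbr _ _
    exact this hx
  let rM : A → M →ₗ[R] M := fun g => (rL g).restrict (rLM g)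
  have rMc : ∀ g (m : M), ((rM g m : M) : L) = rL g m := fun g m => rfl
  have hcomp : ∀ g x (m : M), rM g (t x • m) = t (rL g x) • rM g m := by
    intro g x m
    apply Subtype.ext
    rw [ht, rMc, ht, rLlie, rMc]
  let w : ZMod p → R := fun k => ω ^ k.val
  have wadd : ∀ a b, w (a + b) = w a * w b := by
    intro a b
    simp only [w]
    rw [ZMod.val_add, ← pow_add, ← pow_eq_pow_mod _ hω.pow_eq_one]
  have winj : ∀ k : ZMod p, k ≠ 0 → ∀ x : L, w k • x = x → x = 0 :=
    fun k hk x hx => mbb_inj p ω w (fun _ => rfl) wadd (ρ φ) Li hLi hdec k hk x hx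
  have fixsum : ∀ x : L, (∑ h : H, rL h x) ∈ fixSub ρ (H : Set A) := by
    intro x g hg
    change rL g _ = _
    rw [map_sum, ← Equiv.sum_comp (Equiv.mulLeft (⟨g, hg⟩ : H)) (fun h : H => rL h x)]
    refine Finset.sum_congr rfl fun h _ => ?_
    rw [← rLmul]; rfl
  let cj : H → E ≃ₗ[ZMod p] E := fun h =>
    { cj0 h with
      map_smul' := fun r x => ZMod.map_smul (cj0 h : E →+ E) r x }
  have cjv : ∀ (h : H) (e : E), τ (cj h e) = (h : A) * τ e * (h : A)⁻¹ := τcj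
  let D : MbbData p c d R E H S L M :=
    { w := w
      w0 := by simp [w]
      wadd := wadd
      pu := hpu
      cardE := hEc.trans hFcard
      o := 1
      cj := cj
      cjfree := by
        intro h hh e he
        have h1 := cjv h e
        rw [he, eq_mul_inv_iff_mul_eq] at h1
        apply τinj
        rw [τ0]
        exact hfrob h h.2 (fun h' => hh (Subtype.ext h')) _ (τF e) h1.symm
      cjo := by
        intro e
        apply τinj
        rw [cjv]; simp
      t := t
      tV := fun e => rL (τ e)
      tM := fun e => rM (τ e)
      sV := fun h => rL h
      sM := fun h => rM h
      tV0 := fun x => by rw [τ0]; exact hρone x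
      tM0 := fun x => by rw [τ0]; exact Subtype.ext (hρone x)
      tVadd := fun a b x => by rw [τadd]; exact hρmul _ _ _
      tMadd := fun a b x => by rw [τadd]; exact Subtype.ext (hρmul _ _ _)
      sVo := hρone
      sMo := fun x => Subtype.ext (hρone x)
      sVt := by
        intro h e x
        rw [cjv, ← rLmul, ← rLmul]; congr 2; group
      sMt := by
        intro h e x
        apply Subtype.ext
        simp only [rMc]
        rw [cjv, ← rLmul, ← rLmul]; congr 2; group
      compt := fun e x m => hcomp _ _ _
      comps := fun e x m => hcomp _ _ _
      injV := winj
      injM := fun k hk x hx => Subtype.ext (winj k hk x (congrArg Subtype.val hx))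
      hypF := by
        intro e he m hm s hs
        have h1 := mbb_iter_mem M t ht (fixSub ρ {τ e} : Set L) _
          (fun x hx => by
            rintro g rfl
            exact sub_eq_zero.mp hx) m
          (by
            rintro g rfl
            exact congrArg Subtype.val hm) d s hs
        rw [hdF _ (τF e) (fun h => he (by
          apply τinj
          rw [h, τ0]))] at h1
        exact Subtype.ext h1
      hypH := by
        intro m s hs
        rw [Submodule.map_comp] at hs
        have h1 := mbb_iter_mem M t ht (fixSub ρ (H : Set A) : Set L) _
          (by
            rintro _ ⟨x, -, rfl⟩
            rw [LinearMap.sum_apply]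
            exact fixsum x) (∑ h : H, rM h m)
          (by
            have : ((∑ h : H, rM h m : M) : L) = ∑ h : H, rL h m := by
              rw [AddSubmonoidClass.coe_finsetSum]; rfl
            rw [this]; exact fixsum m) c s hs
        rw [hcH] at h1
        exact Subtype.ext h1 }
  have hcore := D.core
  rw [hq'] at hcore
  exact mbb_final M t ht _ hcore _ _ (fun x hx => hx.1)
end
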